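/- arXiv:1709.05841 — 2 statements merged into one kernel-verified Lean document; each statement's English description precedes it below -/
import Mathlib

section
/- Let Q° = Q°(n,t_1,…,t_n) be the quiver with vertices 0,1,…,n and, for each 1 ≤ i ≤ n, arrows α_{1i},…,α_{t_i i} from vertex i to vertex i−1 (with n ≥ 1 and all t_i ≥ 1; Q° has no loops). Let A° = KQ°/I° with I° an admissible ideal. If A° is geometrically irreducible, then any minimal set of relations generating I° contains no relation involving a path that passes through two or more arrows, i.e. no relation of degree at least 2 with respect to the grading assigning degree 1 to every arrow; equivalently, I° = 0 (since every path of length ≥ 1 in Q° already has degree ≥ 1 and relations are combinations of paths of length ≥ 2, which have degree ≥ 2). -/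
open scoped BigOperators

noncomputable section
/-! ## Quivers and paths -/

/-- A finite quiver: finite sets of vertices and arrows together with source and
target maps. -/
structure FinQuiver : Type 1 where
  V : Type
  A : Type
  [fintypeV : Fintype V]
  [fintypeA : Fintype A]
  [decEqV : DecidableEq V]
  [decEqA : DecidableEq A]
  src : A → V
  tgt : A → V

attribute [instance] FinQuiver.fintypeV FinQuiver.fintypeA FinQuiver.decEqV FinQuiver.decEqA

/-- A path of positive length in a quiver: a list of composable arrows `[a₁, …, aₘ]`
satisfying `s (aᵢ) = t (aᵢ₊₁)`. -/
structure QPath (Q : FinQuiver) : Type where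
  arrows : List Q.A
  ne : arrows ≠ []
  chain : arrows.Chain' fun a b => Q.src a = Q.tgt b

namespace QPath

variable {Q : FinQuiver}

/-- The length of a path. -/
def length (p : QPath Q) : ℕ := p.arrows.length

/-- The target `t (a₁)` of a path `(a₁, …, aₘ)`. -/
def tgt (p : QPath Q) : Q.V := Q.tgt (p.arrows.head p.ne)

/-- The source `s (aₘ)` of a path `(a₁, …, aₘ)`. -/
def src (p : QPath Q) : Q.V := Q.src (p.arrows.getLast p.ne)

/-- A path is a cycle if its source equals its target. -/
def IsCycle (p : QPath Q) : Prop := p.src = p.tgt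

/-- A cycle `(a₁, …, aₘ)` is primitive if the vertices `s (a₁), …, s (aₘ)` are pairwise
different. -/
def IsPrimitive (p : QPath Q) : Prop := (p.arrows.map Q.src).Nodup

end QPath

/-! ## The path algebra, relations, admissible ideals and representation varieties -/

/-- The defining relations presenting the path algebra `KQ` as a quotient of the free
algebra on the vertices and arrows of `Q`: the vertices become a complete set of
orthogonal idempotents summing to `1`, and `e_{t(a)} * a = a = a * e_{s(a)}` for every
arrow `a`. -/
inductive PathRel (K : Type) [Field K] (Q : FinQuiver) :
    FreeAlgebra K (Q.V ⊕ Q.A) → FreeAlgebra K (Q.V ⊕ Q.A) → Prop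
  | idem (i : Q.V) : PathRel K Q
      (FreeAlgebra.ι K (Sum.inl i) * FreeAlgebra.ι K (Sum.inl i)) (FreeAlgebra.ι K (Sum.inl i))
  | orth (i j : Q.V) (h : i ≠ j) : PathRel K Q
      (FreeAlgebra.ι K (Sum.inl i) * FreeAlgebra.ι K (Sum.inl j)) 0
  | sum_one : PathRel K Q (∑ i : Q.V, FreeAlgebra.ι K (Sum.inl i)) 1
  | tgt_mul (a : Q.A) : PathRel K Q
      (FreeAlgebra.ι K (Sum.inl (Q.tgt a)) * FreeAlgebra.ι K (Sum.inr a))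
      (FreeAlgebra.ι K (Sum.inr a))
  | mul_src (a : Q.A) : PathRel K Q
      (FreeAlgebra.ι K (Sum.inr a) * FreeAlgebra.ι K (Sum.inl (Q.src a)))
      (FreeAlgebra.ι K (Sum.inr a))

/-- The path algebra `KQ`. -/
abbrev PathAlgebra (K : Type) [Field K] (Q : FinQuiver) : Type := RingQuot (PathRel K Q)

variable (K : Type) [Field K] (Q : FinQuiver)

/-- The idempotent `eᵢ ∈ KQ` corresponding to a vertex `i` (the path of length zero
at `i`). -/
def vertexElem (i : Q.V) : PathAlgebra K Q :=
  RingQuot.mkAlgHom K (PathRel K Q) (FreeAlgebra.ι K (Sum.inl i))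

/-- The element of `KQ` corresponding to an arrow `a`. -/
def arrowElem (a : Q.A) : PathAlgebra K Q :=
  RingQuot.mkAlgHom K (PathRel K Q) (FreeAlgebra.ι K (Sum.inr a))

/-- The element of `KQ` corresponding to a path `(a₁, …, aₘ)`, namely `a₁ ⋯ aₘ`. -/
def pathElem (p : QPath Q) : PathAlgebra K Q := (p.arrows.map (arrowElem K Q)).prod

/-- The element `∑ₚ c p • p` of `KQ` determined by a finitely supported family of
coefficients on paths. -/
def relElem (c : QPath Q →₀ K) : PathAlgebra K Q := c.sum fun p l => l • pathElem K Q p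

/-- `c` is the datum of a relation with common target `i` and common source `j`: all
paths in its support have length at least two, target `i` and source `j`.  (The paths in
the support are pairwise different and have nonzero coefficients by definition of a
finitely supported function.) -/
def IsRelationData (c : QPath Q →₀ K) (i j : Q.V) : Prop :=
  ∀ p ∈ c.support, 2 ≤ p.length ∧ p.tgt = i ∧ p.src = j

/-- An element of `KQ` is a relation if it is a `K`-linear combination `∑ λₚ • p` of
pairwise different paths of length at least two having a common source and a common
target, with all `λₚ ≠ 0`. -/
def IsRelation (x : PathAlgebra K Q) : Prop :=
  ∃ (c : QPath Q →₀ K) (i j : Q.V), IsRelationData K Q c i j ∧ x = relElem K Q c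

/-- The two-sided ideal generated by a set `S`, as a set: the additive subgroup generated
by all elements `a * s * b` with `s ∈ S`. -/
def twoSidedSpan (R : Type) [Ring R] (S : Set R) : Set R :=
  (AddSubgroup.closure {x | ∃ a b : R, ∃ s ∈ S, x = a * s * b} : AddSubgroup R)

/-- `φ : KQ →ₐ[K] A` presents `A` as `KQ/I` with `I = ker φ` an admissible ideal:
`φ` is surjective, its kernel is generated (as a two-sided ideal) by a set of relations,
and there is some `m ≥ 2` such that all paths of length at least `m` lie in the kernel. -/
def IsAdmissiblePresentation {A : Type} [Ring A] [Algebra K A]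
    (φ : PathAlgebra K Q →ₐ[K] A) : Prop :=
  Function.Surjective φ ∧
  (∃ S : Set (PathAlgebra K Q), (∀ x ∈ S, IsRelation K Q x) ∧
    twoSidedSpan (PathAlgebra K Q) S = {x | φ x = 0}) ∧
  ∃ m : ℕ, 2 ≤ m ∧ ∀ p : QPath Q, m ≤ p.length → φ (pathElem K Q p) = 0

/-- The index type for the rows/columns of the matrices in a `d`-dimensional
representation: the basis vectors of `⊕ᵢ K^{dᵢ}`. -/
abbrev RepIx (d : Q.V → ℕ) : Type := (i : Q.V) × Fin (d i)

/-- The ambient affine space of `d`-dimensional representations.  An arrow `a` gets a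
matrix; membership in `RepSet` forces the matrix of `a` to be concentrated in the block
with rows indexed by the block `t(a)` and columns indexed by the block `s(a)`, i.e. to be
(the block extension of) a `d (t a) × d (s a)`-matrix. -/
abbrev RepSpace (d : Q.V → ℕ) : Type := Q.A → Matrix (RepIx Q d) (RepIx Q d) K

/-- The Zariski topology on affine space `K^ι`: generated by the complements of zero sets
of polynomials in the coordinates. -/
def zariskiTopology (ι R : Type) [CommSemiring R] : TopologicalSpace (ι → R) :=
  TopologicalSpace.generateFrom
    {U | ∃ f : MvPolynomial ι R, U = {x | MvPolynomial.eval x f ≠ 0}}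

/-- The Zariski topology on the ambient space of `d`-dimensional representations. -/
def repTopology (d : Q.V → ℕ) : TopologicalSpace (RepSpace K Q d) :=
  TopologicalSpace.induced (fun M (x : Q.A × RepIx Q d × RepIx Q d) => M x.1 x.2.1 x.2.2)
    (zariskiTopology (Q.A × RepIx Q d × RepIx Q d) K)

/-- The condition that the matrix of each arrow `a` is concentrated in the
`(t a, s a)`-block, i.e. really is a `d (t a) × d (s a)`-matrix. -/
def BlockCompatible (d : Q.V → ℕ) (M : RepSpace K Q d) : Prop :=
  ∀ (a : Q.A) (u v : RepIx Q d), M a u v ≠ 0 → u.1 = Q.tgt a ∧ v.1 = Q.src a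

/-- The evaluation `M(p) = M(a₁) ⋯ M(aₘ)` of a representation at a path. -/
def pathProd (d : Q.V → ℕ) (M : RepSpace K Q d) (p : QPath Q) :
    Matrix (RepIx Q d) (RepIx Q d) K := (p.arrows.map M).prod

/-- The evaluation `M(ρ) = ∑ λₚ M(p)` of a representation at a linear combination of
paths. -/
def relEval (d : Q.V → ℕ) (M : RepSpace K Q d) (c : QPath Q →₀ K) :
    Matrix (RepIx Q d) (RepIx Q d) K := c.sum fun p l => l • pathProd K Q d M p

/-- The affine variety `rep(A, d)` of `d`-dimensional representations of `A = KQ/I`,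
where `I = ker φ`: tuples of matrices (of the correct block sizes) with `M(ρ) = 0` for
every relation `ρ ∈ I`. -/
def RepSet {A : Type} [Ring A] [Algebra K A] (φ : PathAlgebra K Q →ₐ[K] A) (d : Q.V → ℕ) :
    Set (RepSpace K Q d) :=
  {M | BlockCompatible K Q d M ∧
    ∀ (c : QPath Q →₀ K) (i j : Q.V), IsRelationData K Q c i j →
      φ (relElem K Q c) = 0 → relEval K Q d M c = 0}

/-- `A = KQ/I` (presented by `φ`, with `I = ker φ`) is geometrically irreducible if
`rep(A, d)` is an irreducible topological space for every dimension vector `d`. -/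
def IsGeomIrreducible {A : Type} [Ring A] [Algebra K A] (φ : PathAlgebra K Q →ₐ[K] A) :
    Prop :=
  ∀ d : Q.V → ℕ, @IsIrreducible _ (repTopology K Q d) (RepSet K Q φ d)

/-! ## The quiver `Q°(n, t₁, …, tₙ)` (the linear quiver without loops) -/

/-- The quiver `Q°(n, t₁, …, tₙ)`: vertices `0, 1, …, n` and for each `1 ≤ i ≤ n`
the arrows `α_{1i}, …, α_{tᵢi}` from vertex `i` to vertex `i - 1`; it has no loops. -/
def LinearQuiverNoLoops (n : ℕ) (t : Fin n → ℕ) : FinQuiver where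
  V := Fin (n + 1)
  A := (i : Fin n) × Fin (t i)
  src := fun x => x.1.succ
  tgt := fun x => x.1.castSucc

/-! ## Quivers whose arrows strictly decrease a level function -/

section GradedQuiver

variable {K Q} {lev : Q.V → ℕ}

theorem pairwise_lev_tgt (hlev : ∀ a : Q.A, lev (Q.tgt a) < lev (Q.src a)) {L : List Q.A}
    (hL : L.IsChain fun a b => Q.src a = Q.tgt b) :
    L.Pairwise fun a b => lev (Q.tgt a) < lev (Q.tgt b) := by
  have : IsTrans Q.A fun a b => lev (Q.tgt a) < lev (Q.tgt b) := ⟨fun _ _ _ => lt_trans⟩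
  refine List.isChain_iff_pairwise.1 (hL.imp fun a b hab => ?_)
  rw [← hab]
  exact hlev a

theorem list_eq_of_perm (hlev : ∀ a : Q.A, lev (Q.tgt a) < lev (Q.src a)) {L L' : List Q.A}
    (hL : L.IsChain fun a b => Q.src a = Q.tgt b)
    (hL' : L'.IsChain fun a b => Q.src a = Q.tgt b) (h : L.Perm L') : L = L' :=
  h.eq_of_pairwise (fun _ _ _ _ h₁ h₂ => absurd h₁ h₂.asymm)
    (pairwise_lev_tgt hlev hL) (pairwise_lev_tgt hlev hL')

/-- The arrows starting at the vertex `J`. -/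
abbrev ArrowsFrom (J : Q.V) : Type := {a : Q.A // Q.src a = J}

/-- The dimension vector which is the number of arrows starting at `J` at the vertex `J`,
and `1` elsewhere. -/
def outDim (J : Q.V) (v : Q.V) : ℕ := if v = J then Fintype.card (ArrowsFrom J) else 1

theorem outDim_pos {J : Q.V} [Nonempty (ArrowsFrom J)] (v : Q.V) : 0 < outDim J v := by
  unfold outDim
  split_ifs
  · exact Fintype.card_pos
  · exact one_pos

/-- The first basis vector at the vertex `v`. -/
def baseIx (J : Q.V) [Nonempty (ArrowsFrom J)] (v : Q.V) : RepIx Q (outDim J) :=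
  ⟨v, ⟨0, outDim_pos v⟩⟩

/-- The basis vector at `J` attached to an arrow starting at `J`. -/
def outIx {J : Q.V} (q : ArrowsFrom J) : RepIx Q (outDim J) :=
  ⟨J, Fin.cast (by simp [outDim]) (Fintype.equivFin (ArrowsFrom J) q)⟩

theorem outIx_injective {J : Q.V} : Function.Injective (outIx (J := J)) := by
  intro q q' h
  simpa [outIx] using h

theorem eq_baseIx {J : Q.V} [Nonempty (ArrowsFrom J)] {u : RepIx Q (outDim J)}
    (h : u.1 ≠ J) : u = baseIx J u.1 := by
  obtain ⟨v, k⟩ := u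
  have hk : (k : ℕ) < outDim J v := k.2
  simp only [outDim, if_neg h] at hk
  simp only [baseIx, Sigma.mk.injEq, heq_eq_eq, true_and]
  ext
  simpa using hk

/-- In a path ending with an arrow out of `J`, only the basis vectors `baseIx` contribute
to the entries of the evaluation at a representation. -/
theorem prod_apply_baseIx (hlev : ∀ a : Q.A, lev (Q.tgt a) < lev (Q.src a)) {J : Q.V}
    [Nonempty (ArrowsFrom J)] {M : RepSpace K Q (outDim J)}
    (hM : BlockCompatible K Q (outDim J) M) (q : Q.A) (hq : Q.src q = J)
    (u : RepIx Q (outDim J)) (L : List Q.A) :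
    (L ++ [q]).IsChain (fun a b => Q.src a = Q.tgt b) →
    ((L ++ [q]).map M).prod (baseIx J (Q.tgt ((L ++ [q]).head (by simp)))) u =
      (L.map fun x => M x (baseIx J (Q.tgt x)) (baseIx J (Q.src x))).prod *
        M q (baseIx J (Q.tgt q)) u := by
  induction L with
  | nil => intro _; simp
  | cons x L ih =>
    intro hc
    have hc' : (L ++ [q]).IsChain (fun a b => Q.src a = Q.tgt b) := hc.tail
    have hxq : lev (Q.tgt x) < lev (Q.tgt q) := by
      have := pairwise_lev_tgt hlev hc
      rw [List.cons_append, List.pairwise_cons] at this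
      exact this.1 q (by simp)
    have hx : Q.src x = Q.tgt ((L ++ [q]).head (by simp)) := by
      rw [List.cons_append] at hc
      exact (List.isChain_cons.1 hc).1 _ (List.head_mem_head? _)
    have hle : lev (Q.tgt ((L ++ [q]).head (by simp))) ≤ lev (Q.tgt q) := by
      have := pairwise_lev_tgt hlev hc'
      cases L with
      | nil => simp
      | cons y L =>
        rw [List.cons_append, List.pairwise_cons] at this
        exact (this.1 q (by simp)).le
    have hne : Q.src x ≠ J := by
      intro h
      have h₁ := hlev q
      rw [hq, ← h, hx] at h₁
      omega
    simp only [List.cons_append, List.map_cons, List.prod_cons, List.head_cons,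
      Matrix.mul_apply]
    rw [Finset.sum_eq_single (baseIx J (Q.src x))]
    · rw [mul_assoc, ← ih hc', ← hx]
    · intro w _ hw
      by_contra hcon
      have h₁ := (hM x _ _ (left_ne_zero_of_mul hcon)).2
      exact hw (h₁ ▸ eq_baseIx (h₁ ▸ hne))
    · simp

/-- The coordinates of a representation. -/
def repCoord {d : Q.V → ℕ} (M : RepSpace K Q d) (x : Q.A × RepIx Q d × RepIx Q d) : K :=
  M x.1 x.2.1 x.2.2

theorem isOpen_eval_ne_zero {d : Q.V → ℕ}
    (f : MvPolynomial (Q.A × RepIx Q d × RepIx Q d) K) :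
    @IsOpen _ (repTopology K Q d) {M | MvPolynomial.eval (repCoord M) f ≠ 0} :=
  @isOpen_induced _ _ (zariskiTopology _ K) _ _
    (TopologicalSpace.isOpen_generateFrom_of_mem ⟨f, rfl⟩)

variable (K) in
/-- The determinant of the square matrix formed by the arrows out of `J`. -/
def outDet (J : Q.V) [Nonempty (ArrowsFrom J)] :
    MvPolynomial (Q.A × RepIx Q (outDim J) × RepIx Q (outDim J)) K :=
  (Matrix.of fun q s : ArrowsFrom J =>
    (MvPolynomial.X (q.1, baseIx J (Q.tgt q.1), outIx s) : MvPolynomial _ K)).det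

theorem eval_outDet {J : Q.V} [Nonempty (ArrowsFrom J)] (M : RepSpace K Q (outDim J)) :
    MvPolynomial.eval (repCoord M) (outDet K J) =
      (Matrix.of fun q s : ArrowsFrom J => M q.1 (baseIx J (Q.tgt q.1)) (outIx s)).det := by
  rw [outDet, RingHom.map_det]
  congr 1
  ext q s
  simp [repCoord]

/-- The coefficient of the last arrow `q` in a combination of paths, the arrows being
regarded as commuting variables. -/
def lastCoeff (c : QPath Q →₀ K) (q : Q.A) : MvPolynomial Q.A K :=
  ∑ p ∈ c.support with p.arrows.getLast p.ne = q,
    MvPolynomial.monomial (Multiset.toFinsupp (p.arrows.dropLast : Multiset Q.A)) (c p)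

theorem eval_monomial_list (a : Q.A → K) (L : List Q.A) (r : K) :
    MvPolynomial.eval a (MvPolynomial.monomial (Multiset.toFinsupp (L : Multiset Q.A)) r) =
      r * (L.map a).prod := by
  rw [MvPolynomial.eval_monomial, Finsupp.prod, Multiset.toFinsupp_support,
    ← Multiset.prod_coe, ← Multiset.map_coe, Finset.prod_multiset_map_count]
  simp [Multiset.toFinsupp_apply]

theorem eval_lastCoeff (c : QPath Q →₀ K) (q : Q.A) (a : Q.A → K) :
    MvPolynomial.eval a (lastCoeff c q) =
      ∑ p ∈ c.support with p.arrows.getLast p.ne = q, c p * (p.arrows.dropLast.map a).prod := by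
  simp only [lastCoeff, map_sum, eval_monomial_list]

theorem lastCoeff_ne_zero (hlev : ∀ a : Q.A, lev (Q.tgt a) < lev (Q.src a))
    (c : QPath Q →₀ K) (p : QPath Q) (hp : p ∈ c.support) :
    lastCoeff c (p.arrows.getLast p.ne) ≠ 0 := by
  have key : MvPolynomial.coeff (Multiset.toFinsupp (p.arrows.dropLast : Multiset Q.A))
      (lastCoeff c (p.arrows.getLast p.ne)) = c p := by
    rw [lastCoeff, MvPolynomial.coeff_sum, Finset.sum_eq_single p]
    · simp
    · intro p' hp' hne
      rw [MvPolynomial.coeff_monomial, if_neg]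
      intro h
      apply hne
      have hperm := Multiset.coe_eq_coe.1 (Multiset.toFinsupp.injective h)
      have hdrop := list_eq_of_perm hlev (p'.chain.dropLast) (p.chain.dropLast) hperm
      have harr : p'.arrows = p.arrows := by
        rw [← List.dropLast_append_getLast p'.ne, ← List.dropLast_append_getLast p.ne, hdrop,
          (Finset.mem_filter.1 hp').2]
      cases p; cases p'; cases harr; rfl
    · intro h
      simp [Finset.mem_filter, hp] at h
  intro h
  rw [h, MvPolynomial.coeff_zero] at key
  exact Finsupp.mem_support_iff.1 hp key.symm

theorem relEval_apply (hlev : ∀ a : Q.A, lev (Q.tgt a) < lev (Q.src a)) {J i : Q.V}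
    [Nonempty (ArrowsFrom J)] {M : RepSpace K Q (outDim J)}
    (hM : BlockCompatible K Q (outDim J) M) {c : QPath Q →₀ K}
    (hc : IsRelationData K Q c i J) (u : RepIx Q (outDim J)) :
    relEval K Q (outDim J) M c (baseIx J i) u =
      ∑ q : ArrowsFrom J, MvPolynomial.eval
        (fun x => M x (baseIx J (Q.tgt x)) (baseIx J (Q.src x))) (lastCoeff c q.1) *
          M q.1 (baseIx J (Q.tgt q.1)) u := by
  simp only [eval_lastCoeff, Finset.sum_mul, Finset.sum_filter]
  rw [Finset.sum_comm, relEval, Finsupp.sum, Matrix.sum_apply]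
  refine Finset.sum_congr rfl fun p hp => ?_
  obtain ⟨-, ht, hs⟩ := hc p hp
  rw [Finset.sum_eq_single (⟨p.arrows.getLast p.ne, hs⟩ : ArrowsFrom J)]
  · have happ := List.dropLast_append_getLast p.ne
    have hprod := prod_apply_baseIx hlev hM (p.arrows.getLast p.ne) hs u p.arrows.dropLast
      (by rw [happ]; exact p.chain)
    simp only [happ] at hprod
    rw [Matrix.smul_apply, ← ht, if_pos rfl, smul_eq_mul, mul_assoc]
    exact congrArg _ hprod
  · intro q _ hq
    rw [if_neg fun h => hq (Subtype.ext h.symm), zero_mul]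
  · simp

theorem relEval_eq_zero {d : Q.V → ℕ} {M : RepSpace K Q d} {c : QPath Q →₀ K}
    (h : ∀ p ∈ c.support, ∃ a ∈ p.arrows, M a = 0) : relEval K Q d M c = 0 := by
  refine Finset.sum_eq_zero fun p hp => ?_
  obtain ⟨a, ha, h0⟩ := h p hp
  have hprod : pathProd K Q d M p = 0 := List.prod_eq_zero (List.mem_map.2 ⟨a, ha, h0⟩)
  simp only [hprod, smul_zero]

variable {A : Type} [Ring A] [Algebra K A] (φ : PathAlgebra K Q →ₐ[K] A)

/-- The representation where the arrows out of `J` form an identity matrix and all other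
arrows vanish. -/
def outRep (J : Q.V) [Nonempty (ArrowsFrom J)] : RepSpace K Q (outDim J) := fun x =>
  if h : Q.src x = J then Matrix.single (baseIx J (Q.tgt x)) (outIx ⟨x, h⟩) 1 else 0

theorem outRep_mem (hlev : ∀ a : Q.A, lev (Q.tgt a) < lev (Q.src a)) (J : Q.V)
    [Nonempty (ArrowsFrom J)] : outRep J ∈ RepSet K Q φ (outDim J) := by
  refine ⟨fun x u v h => ?_, fun c i j hc _ => relEval_eq_zero fun p hp => ?_⟩
  · unfold outRep at h
    split_ifs at h with hx
    · simp only [Matrix.single_apply, ne_eq, ite_eq_right_iff, one_ne_zero, imp_false,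
        not_not] at h
      rw [← h.1, ← h.2]
      exact ⟨rfl, hx.symm⟩
    · simp at h
  · obtain ⟨hlen, -, -⟩ := hc p hp
    obtain ⟨L, hne, hch⟩ := p
    match L, hne, hch, hlen with
    | x :: y :: L, _, hch, _ =>
      have hxy : Q.src x = Q.tgt y := (List.isChain_cons_cons.1 hch).1
      by_cases hx : Q.src x = J
      · refine ⟨y, by simp, dif_neg fun hy => ?_⟩
        have := hlev y
        rw [hy, ← hxy, hx] at this
        exact lt_irrefl _ this
      · exact ⟨x, by simp, dif_neg hx⟩

theorem eval_outDet_outRep (J : Q.V) [Nonempty (ArrowsFrom J)] :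
    MvPolynomial.eval (repCoord (outRep J)) (outDet K J) = 1 := by
  rw [eval_outDet, ← Matrix.det_one (n := ArrowsFrom J)]
  congr 1
  ext q s
  obtain ⟨q, hq⟩ := q
  simp [outRep, hq, Matrix.single_apply, Matrix.one_apply, outIx_injective.eq_iff]

/-- The representation given by scalars on the arrows out of vertices of level below that
of `J`, all other arrows being zero. -/
def scalarRep (lev : Q.V → ℕ) (J : Q.V) [Nonempty (ArrowsFrom J)] (a : Q.A → K) :
    RepSpace K Q (outDim J) := fun x =>
  if lev (Q.src x) < lev J then Matrix.single (baseIx J (Q.tgt x)) (baseIx J (Q.src x)) (a x)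
  else 0

theorem scalarRep_mem {J : Q.V} [Nonempty (ArrowsFrom J)]
    (hmin : ∀ (j : Q.V), lev j < lev J → ∀ (c : QPath Q →₀ K) (i : Q.V),
      IsRelationData K Q c i j → φ (relElem K Q c) = 0 → c = 0) (a : Q.A → K) :
    scalarRep lev J a ∈ RepSet K Q φ (outDim J) := by
  refine ⟨fun x u v h => ?_, fun c i j hc hφ => ?_⟩
  · unfold scalarRep at h
    split_ifs at h with hx
    · simp only [Matrix.single_apply, ne_eq, ite_eq_right_iff, not_forall] at h
      rw [← h.1.1, ← h.1.2]
      exact ⟨rfl, rfl⟩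
    · simp at h
  · by_cases hj : lev j < lev J
    · rw [hmin j hj c i hc hφ]
      simp [relEval]
    · refine relEval_eq_zero fun p hp => ⟨p.arrows.getLast p.ne, List.getLast_mem _, if_neg ?_⟩
      rw [show Q.src (p.arrows.getLast p.ne) = j from (hc p hp).2.2]
      exact hj

theorem eval_lastCoeff_scalarRep (hlev : ∀ a : Q.A, lev (Q.tgt a) < lev (Q.src a)) {J i : Q.V}
    [Nonempty (ArrowsFrom J)] {c : QPath Q →₀ K} (hc : IsRelationData K Q c i J)
    (q : Q.A) (a : Q.A → K) :
    MvPolynomial.eval (fun x => scalarRep lev J a x (baseIx J (Q.tgt x)) (baseIx J (Q.src x)))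
      (lastCoeff c q) = MvPolynomial.eval a (lastCoeff c q) := by
  simp only [eval_lastCoeff]
  refine Finset.sum_congr rfl fun p hp => ?_
  congr 2
  refine List.map_congr_left fun x hx => ?_
  have hs : Q.src (p.arrows.getLast p.ne) = J := (hc p (Finset.mem_filter.1 hp).1).2.2
  have hch := p.chain
  rw [← List.dropLast_append_getLast p.ne] at hch
  have hlt : lev (Q.src x) < lev J := by
    obtain ⟨L₁, L₂, hL⟩ := List.append_of_mem hx
    rw [hL, List.append_assoc, List.cons_append] at hch
    have hch' := hch.right_of_append
    cases L₂ with
    | nil =>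
      have h₁ := (List.isChain_cons_cons.1 hch').1
      rw [h₁, ← hs]
      exact hlev _
    | cons y L₂ =>
      have h₁ := (List.isChain_cons_cons.1 hch').1
      have h₂ := pairwise_lev_tgt hlev hch'.tail
      rw [List.tail_cons, List.cons_append, List.pairwise_cons] at h₂
      rw [h₁, ← hs]
      exact (h₂.1 (p.arrows.getLast p.ne) (by simp)).trans (hlev _)
  simp [scalarRep, hlt]

/-- If `KQ/I` is geometrically irreducible and the arrows of `Q` strictly decrease a level
function, then `I` contains no nontrivial relation. -/
theorem IsGeomIrreducible.relation_eq_zero [Infinite K]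
    (hlev : ∀ a : Q.A, lev (Q.tgt a) < lev (Q.src a)) (hirr : IsGeomIrreducible K Q φ)
    (J : Q.V) (c : QPath Q →₀ K) (i : Q.V) (hc : IsRelationData K Q c i J)
    (hφ : φ (relElem K Q c) = 0) : c = 0 := by
  induction hN : lev J using Nat.strong_induction_on generalizing J c i with
  | _ N ih =>
  subst hN
  by_contra hne
  obtain ⟨p, hp⟩ := Finsupp.support_nonempty_iff.2 hne
  have hs : Q.src (p.arrows.getLast p.ne) = J := (hc p hp).2.2
  let q : ArrowsFrom J := ⟨p.arrows.getLast p.ne, hs⟩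
  have : Nonempty (ArrowsFrom J) := ⟨q⟩
  obtain ⟨a, ha⟩ : ∃ a, MvPolynomial.eval a (lastCoeff c q.1) ≠ 0 := by
    by_contra! h
    exact lastCoeff_ne_zero hlev c p hp (MvPolynomial.funext fun a => by rw [h a, map_zero])
  let g := MvPolynomial.rename
    (fun x => (x, baseIx J (Q.tgt x), baseIx J (Q.src x))) (lastCoeff c q.1)
  have hg : ∀ M : RepSpace K Q (outDim J), MvPolynomial.eval (repCoord M) g =
      MvPolynomial.eval (fun x => M x (baseIx J (Q.tgt x)) (baseIx J (Q.src x)))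
        (lastCoeff c q.1) := fun M => MvPolynomial.eval_rename _ _ _
  obtain ⟨M, hM, hdet, hgM⟩ := (hirr (outDim J)).2 _ _ (isOpen_eval_ne_zero (outDet K J))
    (isOpen_eval_ne_zero g)
    ⟨outRep J, outRep_mem φ hlev J, by
      rw [Set.mem_ofPred_eq, eval_outDet_outRep]; exact one_ne_zero⟩
    ⟨scalarRep lev J a,
      scalarRep_mem φ (fun j hj c i hc hφ => ih (lev j) hj j c i hc hφ rfl) a, by
      rw [Set.mem_ofPred_eq, hg, eval_lastCoeff_scalarRep hlev hc]; exact ha⟩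
  rw [Set.mem_ofPred_eq, eval_outDet] at hdet
  rw [Set.mem_ofPred_eq, hg] at hgM
  have hzero := Matrix.eq_zero_of_vecMul_eq_zero hdet (v := fun q : ArrowsFrom J =>
      MvPolynomial.eval (fun x => M x (baseIx J (Q.tgt x)) (baseIx J (Q.src x)))
        (lastCoeff c q.1)) <| funext fun s => by
    have h := relEval_apply hlev hM.1 hc (outIx s)
    rw [hM.2 c i J hc hφ] at h
    exact h.symm
  exact hgM (congrFun hzero q)

end GradedQuiver

/-- Let `Q° = Q°(n, t₁, …, tₙ)` be the linear quiver without loops and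
`A° = KQ°/I°` with `I°` admissible.  If `A°` is geometrically irreducible then `I° = 0`,
i.e. the presentation `φ : KQ° → A°` is injective. -/
theorem geomIrreducible_no_loops_implies_no_relations [IsAlgClosed K]
    (n : ℕ) (hn : 1 ≤ n) (t : Fin n → ℕ) (ht : ∀ i, 1 ≤ t i)
    (A : Type) [Ring A] [Algebra K A] [Module.Finite K A]
    (φ : PathAlgebra K (LinearQuiverNoLoops n t) →ₐ[K] A)
    (hadm : IsAdmissiblePresentation K (LinearQuiverNoLoops n t) φ)
    (hirr : IsGeomIrreducible K (LinearQuiverNoLoops n t) φ) :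
    ∀ x : PathAlgebra K (LinearQuiverNoLoops n t), φ x = 0 → x = 0 := by
  have : Infinite K := IsAlgClosed.instInfinite
  obtain ⟨-, ⟨S, hS, hker⟩, -⟩ := hadm
  have hzero : ∀ s ∈ S, s = 0 := by
    intro s hs
    obtain ⟨c, i, j, hc, rfl⟩ := hS s hs
    have hφ : relElem K (LinearQuiverNoLoops n t) c ∈ {x | φ x = 0} := by
      rw [← hker]
      exact AddSubgroup.subset_closure ⟨1, 1, _, hs, by simp⟩
    rw [IsGeomIrreducible.relation_eq_zero (lev := fun v : Fin (n + 1) => (v : ℕ)) φ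
      (fun a => Nat.lt_succ_self _) hirr j c i hc hφ]
    simp [relElem]
  intro x hx
  have hmem : x ∈ twoSidedSpan (PathAlgebra K (LinearQuiverNoLoops n t)) S := by
    rw [hker]
    exact hx
  have hle : AddSubgroup.closure
      {x | ∃ a b : PathAlgebra K (LinearQuiverNoLoops n t), ∃ s ∈ S, x = a * s * b} ≤ ⊥ := by
    rw [AddSubgroup.closure_le]
    rintro _ ⟨a, b, s, hs, rfl⟩
    simp [hzero s hs]
  exact AddSubgroup.mem_bot.1 (hle hmem)
end
end

section
/- Let A = KQ/I be a finite-dimensional algebra over an algebraically closed field K, where Q is a finite quiver and I is an admissible ideal, and assume A is geometrically irreducible. If M is a rigid finite-dimensional A-module (Ext^1_A(M,M) = 0), then the Zariski closure of the G(d)-orbit of M in rep(A,d) (where d is the dimension vector of M) is an irreducible component of rep(A,d), and consequently M is locally free. -/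
open scoped BigOperators

noncomputable section
variable (K : Type) [Field K] (Q : FinQuiver)

/-! ## Rigid modules -/

/-- `Ext¹_A(M, M) = 0`, phrased elementarily: every short exact sequence
`0 → M → E → M → 0` splits. -/
def RigidModule (A : Type) [Ring A] (M : Type) [AddCommGroup M] [Module A M] : Prop :=
  ∀ (E : Type) [AddCommGroup E] [Module A E], ∀ (f : M →ₗ[A] E) (g : E →ₗ[A] M),
    Function.Injective f → Function.Surjective g → LinearMap.range f = LinearMap.ker g →
    ∃ s : M →ₗ[A] E, g.comp s = LinearMap.id

/-! ## Corner rings `eAe` and local freeness -/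

/-- An idempotent element of a ring. -/
structure IdemElem (A : Type) [Ring A] : Type where
  e : A
  idem : e * e = e

/-- The corner ring `eAe` of an idempotent `e`. -/
def Corner {A : Type} [Ring A] (ε : IdemElem A) : Type :=
  {x : A // ε.e * x = x ∧ x * ε.e = x}

namespace Corner

variable {A : Type} [Ring A] {ε : IdemElem A}

instance : Zero (Corner ε) := ⟨⟨0, by simp⟩⟩
instance : Add (Corner ε) :=
  ⟨fun x y => ⟨x.1 + y.1, by rw [mul_add, x.2.1, y.2.1], by rw [add_mul, x.2.2, y.2.2]⟩⟩
instance : Neg (Corner ε) :=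
  ⟨fun x => ⟨-x.1, by rw [mul_neg, x.2.1], by rw [neg_mul, x.2.2]⟩⟩
instance : One (Corner ε) := ⟨⟨ε.e, ε.idem, ε.idem⟩⟩
instance : Mul (Corner ε) :=
  ⟨fun x y => ⟨x.1 * y.1, by rw [← mul_assoc, x.2.1], by rw [mul_assoc, y.2.2]⟩⟩

instance instRing : Ring (Corner ε) where
  add_assoc x y z := Subtype.ext (add_assoc _ _ _)
  zero_add x := Subtype.ext (zero_add _)
  add_zero x := Subtype.ext (add_zero _)
  add_comm x y := Subtype.ext (add_comm _ _)
  neg_add_cancel x := Subtype.ext (neg_add_cancel _)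
  mul_assoc x y z := Subtype.ext (mul_assoc _ _ _)
  one_mul x := Subtype.ext x.2.1
  mul_one x := Subtype.ext x.2.2
  left_distrib x y z := Subtype.ext (left_distrib _ _ _)
  right_distrib x y z := Subtype.ext (right_distrib _ _ _)
  zero_mul x := Subtype.ext (zero_mul _)
  mul_zero x := Subtype.ext (mul_zero _)
  nsmul := nsmulRec
  zsmul := zsmulRec

end Corner

/-- The subgroup `eM` of an `A`-module `M`, as a module over the corner ring `eAe`. -/
def CornerMod {A : Type} [Ring A] (ε : IdemElem A) (M : Type) [AddCommGroup M]
    [Module A M] : Type :=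
  {m : M // ε.e • m = m}

namespace CornerMod

variable {A : Type} [Ring A] {ε : IdemElem A} {M : Type} [AddCommGroup M] [Module A M]

instance : Zero (CornerMod ε M) := ⟨⟨0, smul_zero _⟩⟩
instance : Add (CornerMod ε M) := ⟨fun x y => ⟨x.1 + y.1, by rw [smul_add, x.2, y.2]⟩⟩
instance : Neg (CornerMod ε M) := ⟨fun x => ⟨-x.1, by rw [smul_neg, x.2]⟩⟩

instance instAddCommGroup : AddCommGroup (CornerMod ε M) where
  add_assoc x y z := Subtype.ext (add_assoc _ _ _)
  zero_add x := Subtype.ext (zero_add _)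
  add_zero x := Subtype.ext (add_zero _)
  add_comm x y := Subtype.ext (add_comm _ _)
  neg_add_cancel x := Subtype.ext (neg_add_cancel _)
  nsmul := nsmulRec
  zsmul := zsmulRec

instance instSMul : SMul (Corner ε) (CornerMod ε M) :=
  ⟨fun c m => ⟨c.1 • m.1, by rw [smul_smul, c.2.1]⟩⟩

theorem val_smul (c : Corner ε) (m : CornerMod ε M) : (c • m).1 = c.1 • m.1 := rfl
theorem val_zero : (0 : CornerMod ε M).1 = 0 := rfl
theorem val_add (m n : CornerMod ε M) : (m + n).1 = m.1 + n.1 := rfl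

instance instModule : Module (Corner ε) (CornerMod ε M) where
  one_smul m := Subtype.ext (by rw [val_smul]; exact m.2)
  mul_smul c d m := Subtype.ext (by simp only [val_smul]; exact mul_smul c.1 d.1 m.1)
  smul_zero c := Subtype.ext (by simp only [val_smul, val_zero]; exact smul_zero c.1)
  smul_add c m n := Subtype.ext
    (by simp only [val_smul, val_add]; exact smul_add c.1 m.1 n.1)
  add_smul c d m := Subtype.ext
    (by simp only [val_smul, val_add]; exact add_smul c.1 d.1 m.1)
  zero_smul m := Subtype.ext (by simp only [val_smul, val_zero]; exact zero_smul A m.1)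

end CornerMod

theorem vertexElem_mul_self (i : Q.V) :
    vertexElem K Q i * vertexElem K Q i = vertexElem K Q i := by
  rw [vertexElem, ← map_mul]
  exact RingQuot.mkAlgHom_rel K (PathRel.idem i)

/-- The idempotent `eᵢ ∈ A = KQ/I` corresponding to a vertex `i`. -/
def vertexIdem {A : Type} [Ring A] [Algebra K A] (φ : PathAlgebra K Q →ₐ[K] A)
    (i : Q.V) : IdemElem A :=
  ⟨φ (vertexElem K Q i), by rw [← map_mul, vertexElem_mul_self]⟩

/-- An `A = KQ/I`-module `M` is locally free if `eᵢM` is a free `eᵢAeᵢ`-module for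
every vertex `i`. -/
def IsLocallyFree {A : Type} [Ring A] [Algebra K A] (φ : PathAlgebra K Q →ₐ[K] A)
    (M : Type) [AddCommGroup M] [Module A M] : Prop :=
  ∀ i : Q.V,
    Module.Free (Corner (vertexIdem K Q φ i)) (CornerMod (vertexIdem K Q φ i) M)

/-! ## The group action on representation varieties -/

/-- The block-diagonal invertible matrix determined by a tuple
`g ∈ G(d) = ∏ᵢ GLᵢ(K)`. -/
def blockDiag {d : Q.V → ℕ} (g : (i : Q.V) → GL (Fin (d i)) K) :
    Matrix (RepIx Q d) (RepIx Q d) K :=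
  fun u v => if h : v.1 = u.1 then (g u.1 : Matrix (Fin (d u.1)) (Fin (d u.1)) K) u.2 (h ▸ v.2) else 0

/-- The `G(d)`-orbit of a point of the representation space, for the conjugation
action. -/
def repOrbit (d : Q.V → ℕ) (x : RepSpace K Q d) : Set (RepSpace K Q d) :=
  {y | ∃ g : (i : Q.V) → GL (Fin (d i)) K,
    ∀ a : Q.A, y a = blockDiag K Q g * x a * blockDiag K Q (fun i => (g i)⁻¹)}

namespace MvPolynomial
variable {ι k : Type*} [Fintype ι] [Field k]

/-- The linear part of a polynomial, as a linear form on affine space. -/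
def linPart : MvPolynomial ι k →ₗ[k] Module.Dual k (ι → k) :=
  ∑ i, (lcoeff k (Finsupp.single i 1)).smulRight (LinearMap.proj i)

theorem linPart_apply (f : MvPolynomial ι k) (z : ι → k) :
    linPart f z = ∑ i, coeff (Finsupp.single i 1) f * z i := by
  simp [linPart]

theorem linPart_C (c : k) : linPart (C c : MvPolynomial ι k) = 0 := by
  ext i
  classical
  simp only [linPart, LinearMap.sum_apply, LinearMap.smulRight_apply, lcoeff_apply, coeff_C]
  refine Finset.sum_eq_zero fun j _ => ?_
  rw [if_neg (by simp [eq_comm]), zero_smul]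
  rfl

theorem linPart_mul_X (f : MvPolynomial ι k) (i : ι) :
    linPart (f * X i) = coeff 0 f • LinearMap.proj i := by
  classical
  refine LinearMap.ext fun z => ?_
  rw [linPart_apply]
  simp only [coeff_mul_X', LinearMap.smul_apply, LinearMap.proj_apply, smul_eq_mul]
  rw [Finset.sum_eq_single i]
  · simp
  · intro j _ hj
    rw [if_neg]
    · simp
    · simpa using hj.symm
  · simp

theorem linPart_X (i : ι) : linPart (X i : MvPolynomial ι k) = LinearMap.proj i := by
  simpa using linPart_mul_X (1 : MvPolynomial ι k) i

theorem mem_idealOfVars_sq {f : MvPolynomial ι k} (h0 : coeff 0 f = 0) (h1 : linPart f = 0) :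
    f ∈ idealOfVars ι k ^ 2 := by
  classical
  rw [mem_pow_idealOfVars_iff']
  intro x hx
  have : x.degree = 0 ∨ x.degree = 1 := by omega
  rcases this with h | h
  · rw [(Finsupp.degree_eq_zero_iff x).1 h, h0]
  · obtain ⟨i, rfl⟩ : ∃ i, x = Finsupp.single i 1 := by
      exact (Finsupp.sum_eq_one_iff x).1 h
    have := LinearMap.congr_fun h1 (Pi.single i 1)
    rw [linPart_apply] at this
    simpa [Pi.single_apply] using this

/-- Dual-number points along a vector. -/
theorem aeval_eps_smul (z : ι → k) (f : MvPolynomial ι k) :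
    aeval (fun i => (z i) • (DualNumber.eps : DualNumber k)) f =
      algebraMap k _ (coeff 0 f) + linPart f z • DualNumber.eps := by
  induction f using MvPolynomial.induction_on with
  | C c => rw [linPart_C]; simp
  | add p q hp hq => 
    simp only [map_add, hp, hq, coeff_add, LinearMap.add_apply, add_smul]; abel
  | mul_X p i hp =>
    classical
    rw [map_mul, hp, linPart_mul_X, aeval_X, coeff_mul_X']
    simp only [Finsupp.support_zero, Finset.notMem_empty, if_false, map_zero, zero_add,
      LinearMap.smul_apply, LinearMap.proj_apply]
    rw [add_mul, smul_mul_smul_comm, DualNumber.eps_mul_eps, smul_zero, add_zero,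
      ← Algebra.smul_def, smul_smul, smul_eq_mul]

variable (J : Ideal (MvPolynomial ι k))

/-- The tangent space at the origin of the scheme cut out by `J`. -/
def tangentSpace : Submodule k (ι → k) :=
  (Submodule.map linPart (J.restrictScalars k)).dualCoannihilator

variable {J}

theorem mem_tangentSpace {z : ι → k} : z ∈ tangentSpace J ↔ ∀ f ∈ J, linPart f z = 0 := by
  simp [tangentSpace, Submodule.mem_dualCoannihilator]

theorem exists_linPart_eq (l : Module.Dual k (ι → k)) (hl : ∀ z ∈ tangentSpace J, l z = 0) :
    ∃ f ∈ J, linPart f = l := by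
  have : l ∈ (tangentSpace J).dualAnnihilator := by
    simpa [Submodule.mem_dualAnnihilator] using hl
  rw [tangentSpace, Subspace.dualCoannihilator_dualAnnihilator_eq] at this
  simpa using this

/-- The substitution by linear forms attached to an endomorphism of affine space. -/
def linSubst [DecidableEq ι] (π : (ι → k) →ₗ[k] ι → k) : MvPolynomial ι k →ₐ[k] MvPolynomial ι k :=
  aeval fun i => ∑ j, C (π (Pi.single j 1) i) * X j

variable [DecidableEq ι]

theorem eval_linSubst (π : (ι → k) →ₗ[k] ι → k) (f : MvPolynomial ι k) (z : ι → k) :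
    eval z (linSubst π f) = eval (π z) f := by
  have : (aeval z).comp (linSubst π) = aeval (R := k) (π z) := by
    ext i
    simp only [linSubst, AlgHom.comp_apply, aeval_X, map_sum, map_mul, algHom_C]
    conv_rhs => rw [← LinearMap.sum_single_apply  (fun _ => k) z, map_sum, Finset.sum_apply]
    refine Finset.sum_congr rfl fun j _ => ?_
    rw [show (Pi.single j (z j) : ι → k) = z j • Pi.single j 1 by
      rw [← Pi.single_smul, smul_eq_mul, mul_one], map_smul]
    simp [mul_comm]
  exact DFunLike.congr_fun this f

omit [Fintype ι] in
theorem sub_C_coeff_mem (f : MvPolynomial ι k) : f - C (coeff 0 f) ∈ idealOfVars ι k := by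
  have : f - C (coeff 0 f) ∈ idealOfVars ι k ^ 1 := by
    rw [mem_pow_idealOfVars_iff']
    intro x hx
    rw [(Finsupp.degree_eq_zero_iff x).1 (by omega)]
    simp
  simpa using this

theorem coeff_zero_linSubst (π : (ι → k) →ₗ[k] ι → k) (f : MvPolynomial ι k) :
    coeff 0 (linSubst π f) = coeff 0 f := by
  have := eval_linSubst π f 0
  rw [map_zero] at this
  simpa [constantCoeff_eq] using this

theorem sub_linSubst_mem_vars (π : (ι → k) →ₗ[k] ι → k) (f : MvPolynomial ι k) :
    f - linSubst π f ∈ idealOfVars ι k := by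
  have h1 := sub_C_coeff_mem f
  have h2 := sub_C_coeff_mem (linSubst π f)
  rw [coeff_zero_linSubst] at h2
  simpa using Ideal.sub_mem _ h1 h2

theorem linSubst_mem_vars (π : (ι → k) →ₗ[k] ι → k) {f : MvPolynomial ι k}
    (hf : f ∈ idealOfVars ι k) : linSubst π f ∈ idealOfVars ι k := by
  simpa using Ideal.sub_mem _ hf (sub_linSubst_mem_vars π f)

theorem linPart_linSubst_X (π : (ι → k) →ₗ[k] ι → k) (i : ι) (z : ι → k) :
    linPart (linSubst π (X i)) z = π z i := by
  rw [linSubst, aeval_X]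
  simp only [map_sum, linPart_mul_X, LinearMap.sum_apply, LinearMap.smul_apply,
    LinearMap.proj_apply, coeff_C, if_true, smul_eq_mul]
  conv_rhs => rw [← LinearMap.sum_single_apply  (fun _ => k) z, map_sum, Finset.sum_apply]
  refine Finset.sum_congr rfl fun j _ => ?_
  rw [show (Pi.single j (z j) : ι → k) = z j • Pi.single j 1 by
    rw [← Pi.single_smul, smul_eq_mul, mul_one], map_smul]
  simp [mul_comm]

theorem X_sub_linSubst_mem (hJ : J ≤ idealOfVars ι k) (π : (ι → k) →ₗ[k] ι → k)
    (hπ : ∀ z ∈ tangentSpace J, π z = z) (i : ι) :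
    X i - linSubst π (X i) ∈ J ⊔ idealOfVars ι k ^ 2 := by
  obtain ⟨f, hf, hl⟩ := exists_linPart_eq (J := J) (linPart (X i - linSubst π (X i)))
    (fun z hz => by
      rw [map_sub, LinearMap.sub_apply, linPart_linSubst_X, linPart_X, hπ z hz]; simp)
  have hcoeff : ∀ g ∈ idealOfVars ι k, coeff 0 g = 0 := fun g hg => by
    have := (mem_pow_idealOfVars_iff' 1 g).1 (by simpa using hg) 0 (by simp)
    exact this
  have h2 : X i - linSubst π (X i) - f ∈ idealOfVars ι k ^ 2 := by
    apply mem_idealOfVars_sq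
    · apply hcoeff
      exact Ideal.sub_mem _ (sub_linSubst_mem_vars π _) (hJ hf)
    · rw [map_sub, hl, sub_self]
  have := Ideal.add_mem _ (Ideal.mem_sup_left hf : f ∈ J ⊔ idealOfVars ι k ^ 2)
    (Ideal.mem_sup_right h2)
  simpa using this

theorem sub_linSubst_mem_sq (hJ : J ≤ idealOfVars ι k) (π : (ι → k) →ₗ[k] ι → k)
    (hπ : ∀ z ∈ tangentSpace J, π z = z) {f : MvPolynomial ι k} (hf : f ∈ idealOfVars ι k) :
    f - linSubst π f ∈ J ⊔ idealOfVars ι k ^ 2 := by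
  induction hf using Submodule.span_induction with
  | mem x hx => obtain ⟨i, rfl⟩ := hx; exact X_sub_linSubst_mem hJ π hπ i
  | zero => simp
  | add x y _ _ hx hy =>
    have := Ideal.add_mem _ hx hy
    rw [map_add]; convert this using 1; ring
  | smul a x hx h =>
    have hx' : x ∈ idealOfVars ι k := hx
    rw [smul_eq_mul, map_mul]
    have e : a * x - linSubst π a * linSubst π x =
      a * (x - linSubst π x) + (a - linSubst π a) * linSubst π x := by ring
    rw [e]
    refine Ideal.add_mem _ (Ideal.mul_mem_left _ _ h) (Ideal.mem_sup_right ?_)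
    rw [pow_two]
    exact Ideal.mul_mem_mul (sub_linSubst_mem_vars π a) (linSubst_mem_vars π hx')

theorem sub_linSubst_mem_pow (hJ : J ≤ idealOfVars ι k) (π : (ι → k) →ₗ[k] ι → k)
    (hπ : ∀ z ∈ tangentSpace J, π z = z) (n : ℕ) {f : MvPolynomial ι k}
    (hf : f ∈ idealOfVars ι k ^ n) :
    f - linSubst π f ∈ J ⊔ idealOfVars ι k ^ (n + 1) := by
  induction n generalizing f with
  | zero => simpa using Ideal.mem_sup_right (sub_linSubst_mem_vars π f)
  | succ n ih =>
    rw [pow_succ'] at hf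
    induction hf using Submodule.mul_induction_on' with
    | mem_mul_mem a ha b hb =>
      have e : a * b - linSubst π (a * b) =
        b * (a - linSubst π a) + linSubst π a * (b - linSubst π b) := by rw [map_mul]; ring
      rw [e]
      have key : ∀ (c d : MvPolynomial ι k) (p q : ℕ), c ∈ idealOfVars ι k ^ p →
          d ∈ J ⊔ idealOfVars ι k ^ q → c * d ∈ J ⊔ idealOfVars ι k ^ (p + q) := by
        intro c d p q hc hd
        obtain ⟨u, hu, v, hv, rfl⟩ := Submodule.mem_sup.1 hd
        rw [mul_add, pow_add]
        exact Ideal.add_mem _ (Ideal.mem_sup_left (Ideal.mul_mem_left _ _ hu))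
          (Ideal.mem_sup_right (Ideal.mul_mem_mul hc hv))
      refine Ideal.add_mem _ (key _ _ n 2 hb (sub_linSubst_mem_sq hJ π hπ ha)) ?_
      have := key _ _ 1 (n + 1) (by simpa using linSubst_mem_vars π ha) (ih hb)
      rwa [add_comm 1] at this
    | add x _ y _ hx hy =>
      have := Ideal.add_mem _ hx hy
      rw [map_add]; convert this using 1; ring

theorem linSubst_eq_zero [Infinite k] (π : (ι → k) →ₗ[k] ι → k)
    {f : MvPolynomial ι k} (h : ∀ z, eval (π z) f = 0) : linSubst π f = 0 :=
  MvPolynomial.funext fun z => by rw [eval_linSubst, h, map_zero]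

omit [Fintype ι] [DecidableEq ι] in
theorem sub_homogeneousComponent_mem {n : ℕ} {f : MvPolynomial ι k}
    (hf : f ∈ idealOfVars ι k ^ n) :
    f - homogeneousComponent n f ∈ idealOfVars ι k ^ (n + 1) := by
  classical
  rw [mem_pow_idealOfVars_iff'] at hf ⊢
  intro x hx
  rw [coeff_sub, coeff_homogeneousComponent]
  split_ifs with h
  · simp
  · rw [hf x (by omega), sub_zero]

omit [DecidableEq ι] in
theorem aeval_smul_of_isHomogeneous {S : Type*} [CommRing S] [Algebra k S] {n : ℕ}
    {f : MvPolynomial ι k} (hf : f.IsHomogeneous n) (s : S) (u : ι → S) :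
    aeval (fun i => s * u i) f = s ^ n * aeval u f := by
  rw [aeval_def, aeval_def, eval₂_eq, eval₂_eq, Finset.mul_sum]
  refine Finset.sum_congr rfl fun d hd => ?_
  have hdeg : d.degree = n := by
    by_contra hne
    exact (mem_support_iff.1 hd) (hf.coeff_eq_zero hne)
  rw [← hdeg]
  simp only [mul_pow, Finset.prod_mul_distrib, Finset.prod_pow_eq_pow_sum]
  rw [Finsupp.degree_eq_sum, Finset.sum_subset (Finset.subset_univ d.support)]
  · ring
  · intro i _ hi; simpa using hi

/-- A formal arc through the origin with tangent vector `z` along which `I` vanishes. -/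
structure HasArc (I : Ideal (MvPolynomial ι k)) (z : ι → k) : Prop where
  exists_arc : ∃ (S : Type) (_ : CommRing S) (_ : IsDomain S) (_ : Algebra k S) (s : S)
    (ev : S →ₐ[k] k) (u : ι → S), s ≠ 0 ∧ ev s = 0 ∧ (∀ i, ev (u i) = z i) ∧
      ∀ f ∈ I, aeval (fun i => s * u i) f = 0

omit [DecidableEq ι] in
theorem HasArc.eval_homogeneousComponent_eq_zero {I : Ideal (MvPolynomial ι k)} {z : ι → k}
    (h : HasArc I z) {n : ℕ} {f : MvPolynomial ι k} (hf : f ∈ I)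
    (hn : f ∈ idealOfVars ι k ^ n) : eval z (homogeneousComponent n f) = 0 := by
  obtain ⟨S, _, _, _, s, ev, u, hs, hev, hu, hI⟩ := h.exists_arc
  have h1 := hI f hf
  have h2 : aeval (fun i => s * u i) (f - homogeneousComponent n f) ∈
      Ideal.span {s} ^ (n + 1) := by
    have hle : idealOfVars ι k ≤ (Ideal.span {s}).comap (aeval (R := k) fun i => s * u i) := by
      rw [Ideal.span_le]
      rintro _ ⟨i, rfl⟩
      simp [Ideal.mem_span_singleton]
    exact (Ideal.pow_right_mono hle (n + 1) |>.trans (Ideal.le_comap_pow _ _))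
      (sub_homogeneousComponent_mem hn)
  rw [map_sub, h1, aeval_smul_of_isHomogeneous (homogeneousComponent_isHomogeneous n f),
    zero_sub, Ideal.span_singleton_pow, Ideal.mem_span_singleton, dvd_neg, pow_succ,
    mul_dvd_mul_iff_left (pow_ne_zero _ hs)] at h2
  obtain ⟨w, hw⟩ := h2
  have h3 := congrArg ev hw
  rw [map_mul, hev, zero_mul] at h3
  have h4 : (ev.comp (aeval u)) = aeval (R := k) z := by ext i; simp [hu]
  exact (DFunLike.congr_fun h4 (homogeneousComponent n f)).symm.trans h3

/-- If every tangent vector of the scheme defined by `J` is the velocity of an arc along which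
the larger ideal `I` vanishes, then `J` and `I` agree after localization at the origin. -/
theorem exists_one_sub_mul_mem [Infinite k] {I : Ideal (MvPolynomial ι k)}
    (hJ : J ≤ idealOfVars ι k) (hJI : J ≤ I) (harc : ∀ z ∈ tangentSpace J, HasArc I z)
    {f : MvPolynomial ι k} (hf : f ∈ I) :
    ∃ r ∈ idealOfVars ι k, (1 - r) * f ∈ J := by
  obtain ⟨π₀, hπ₀⟩ := LinearMap.exists_leftInverse_of_injective (tangentSpace J).subtype
    (Submodule.ker_subtype _)
  set π := (tangentSpace J).subtype.comp π₀ with hπdef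
  have hπ : ∀ z ∈ tangentSpace J, π z = z := fun z hz => by
    have := LinearMap.congr_fun hπ₀ ⟨z, hz⟩
    simpa [hπdef] using congrArg Subtype.val this
  have hmem : ∀ z, π z ∈ tangentSpace J := fun z => (π₀ z).2
  have step : ∀ n, f ∈ J ⊔ idealOfVars ι k ^ n := by
    intro n
    induction n with
    | zero => simp
    | succ n ih =>
      obtain ⟨j, hj, g, hg, rfl⟩ := Submodule.mem_sup.1 ih
      refine Ideal.add_mem _ (Ideal.mem_sup_left hj) ?_
      have hgI : g ∈ I := by simpa using I.sub_mem hf (hJI hj)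
      have h1 := sub_homogeneousComponent_mem hg
      have h2 : homogeneousComponent n g ∈ idealOfVars ι k ^ n := by
        have := Ideal.sub_mem _ hg (Ideal.pow_le_pow_right n.le_succ h1)
        simpa using this
      have h3 := sub_linSubst_mem_pow hJ π hπ n h2
      rw [linSubst_eq_zero π fun z =>
        (harc _ (hmem z)).eval_homogeneousComponent_eq_zero hgI hg, sub_zero] at h3
      simpa using Ideal.add_mem _ (Ideal.mem_sup_right h1) h3
  have hq : (Ideal.Quotient.mk J f) ∈ (⨅ i : ℕ, ((idealOfVars ι k) ^ i) •
      (⊤ : Submodule (MvPolynomial ι k) (MvPolynomial ι k ⧸ J))) := by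
    rw [Submodule.mem_iInf]
    intro n
    obtain ⟨j, hj, g, hg, hjg⟩ := Submodule.mem_sup.1 (step n)
    have : Ideal.Quotient.mk J f = g • (1 : MvPolynomial ι k ⧸ J) := by
      rw [← hjg, map_add, Ideal.Quotient.eq_zero_iff_mem.2 hj, zero_add,
        ← map_one (Ideal.Quotient.mk J)]
      exact congrArg (Ideal.Quotient.mk J) (mul_one g).symm
    rw [this]
    exact Submodule.smul_mem_smul hg trivial
  obtain ⟨r, hr⟩ := (Ideal.mem_iInf_smul_pow_eq_bot_iff _ _).1 hq
  refine ⟨r, r.2, ?_⟩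
  rw [← Ideal.Quotient.eq_zero_iff_mem, sub_mul, one_mul, map_sub, sub_eq_zero, map_mul, eq_comm]
  exact hr

end MvPolynomial

section AlgebraHoms

variable {K Q} {B : Type*} [Ring B] [Algebra K B]

/-- The value of a linear combination of paths on a family of elements of an algebra. -/
def relSum (y : Q.A → B) (c : QPath Q →₀ K) : B :=
  c.sum fun p l => l • (p.arrows.map y).prod

theorem map_relSum {B' : Type*} [Ring B'] [Algebra K B'] (f : B →ₐ[K] B') (y : Q.A → B)
    (c : QPath Q →₀ K) : f (relSum y c) = relSum (fun a => f (y a)) c := by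
  simp only [relSum, Finsupp.sum, map_sum, map_smul, map_list_prod, List.map_map]
  rfl

theorem list_prod_conj {X : Type*} (y : X → B) {g g' : B} (h : g' * g = 1) (h' : g * g' = 1)
    (l : List X) : (l.map fun a => g * y a * g').prod = g * (l.map y).prod * g' := by
  induction l with
  | nil => simp [h']
  | cons a l ih =>
    simp only [List.map_cons, List.prod_cons, ih]
    calc g * y a * g' * (g * (l.map y).prod * g')
        = g * y a * (g' * g) * (l.map y).prod * g' := by simp only [mul_assoc]
      _ = _ := by rw [h, mul_one]; simp only [mul_assoc]

theorem relSum_conj (y : Q.A → B) {g g' : B} (h : g' * g = 1) (h' : g * g' = 1)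
    (c : QPath Q →₀ K) : relSum (fun a => g * y a * g') c = g * relSum y c * g' := by
  simp only [relSum, Finsupp.sum, list_prod_conj y h h', Finset.mul_sum, Finset.sum_mul,
    mul_smul_comm, smul_mul_assoc]

theorem exists_pathAlgebra_algHom (e : Q.V → B) (y : Q.A → B) (idem : ∀ i, e i * e i = e i)
    (orth : ∀ i j, i ≠ j → e i * e j = 0) (hsum : ∑ i, e i = 1)
    (htgt : ∀ a, e (Q.tgt a) * y a = y a) (hsrc : ∀ a, y a * e (Q.src a) = y a) :
    ∃ θ : PathAlgebra K Q →ₐ[K] B, (∀ i, θ (vertexElem K Q i) = e i) ∧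
      ∀ a, θ (arrowElem K Q a) = y a := by
  have w : ∀ ⦃p q⦄, PathRel K Q p q → FreeAlgebra.lift K (Sum.elim e y) p =
      FreeAlgebra.lift K (Sum.elim e y) q := by
    intro p q h
    cases h with
    | idem i => simpa using idem i
    | orth i j h => simpa using orth i j h
    | sum_one => simpa using hsum
    | tgt_mul a => simpa using htgt a
    | mul_src a => simpa using hsrc a
  refine ⟨RingQuot.liftAlgHom K ⟨FreeAlgebra.lift K (Sum.elim e y), w⟩, fun i => ?_, fun a => ?_⟩
  · rw [vertexElem, RingQuot.liftAlgHom_mkAlgHom_apply]; simp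
  · rw [arrowElem, RingQuot.liftAlgHom_mkAlgHom_apply]; simp

variable {A : Type} [Ring A] [Algebra K A] {φ : PathAlgebra K Q →ₐ[K] A}

theorem exists_algHom_of_relations (hadm : IsAdmissiblePresentation K Q φ)
    (e : Q.V → B) (y : Q.A → B) (idem : ∀ i, e i * e i = e i)
    (orth : ∀ i j, i ≠ j → e i * e j = 0) (hsum : ∑ i, e i = 1)
    (htgt : ∀ a, e (Q.tgt a) * y a = y a) (hsrc : ∀ a, y a * e (Q.src a) = y a)
    (hrel : ∀ (c : QPath Q →₀ K) (i j : Q.V), IsRelationData K Q c i j →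
      φ (relElem K Q c) = 0 → relSum y c = 0) :
    ∃ ρ : A →ₐ[K] B, (∀ i, ρ (φ (vertexElem K Q i)) = e i) ∧
      ∀ a, ρ (φ (arrowElem K Q a)) = y a := by
  obtain ⟨θ, hθe, hθy⟩ := exists_pathAlgebra_algHom (K := K) e y idem orth hsum htgt hsrc
  obtain ⟨hsurj, ⟨S, hS, hker⟩, -⟩ := hadm
  have hle : ∀ z, φ z = 0 → θ z = 0 := by
    intro z hz
    have hz' : z ∈ twoSidedSpan (PathAlgebra K Q) S := by rw [hker]; exact hz
    have hS0 : ∀ s ∈ S, θ s = 0 := by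
      intro s hs
      have hs0 : φ s = 0 := by
        have : s ∈ twoSidedSpan (PathAlgebra K Q) S :=
          AddSubgroup.subset_closure ⟨1, 1, s, hs, by simp⟩
        rwa [hker] at this
      obtain ⟨c, i, j, hc, rfl⟩ := hS s hs
      have := map_relSum θ (arrowElem K Q) c
      simp only [hθy] at this
      exact this.trans (hrel c i j hc hs0)
    refine AddSubgroup.closure_induction (p := fun z _ => θ z = 0) ?_ (map_zero θ) ?_ ?_ hz'
    · rintro _ ⟨a, b, s, hs, rfl⟩
      simp [hS0 s hs]
    · intro a b _ _ ha hb; simp [ha, hb]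
    · intro a _ ha; simp [ha]
  have hfac : ∀ z z', φ z = φ z' → θ z = θ z' := fun z z' h => by
    rw [← sub_eq_zero, ← map_sub]; exact hle _ (by rw [map_sub, h, sub_self])
  have hinv := Function.surjInv_eq hsurj
  refine ⟨{ toFun := fun a => θ (Function.surjInv hsurj a)
            map_one' := by
              rw [hfac _ 1 (by rw [hinv, map_one]), map_one]
            map_mul' := fun a b => by
              rw [← map_mul]; exact hfac _ _ (by rw [map_mul, hinv, hinv, hinv])
            map_zero' := by
              rw [hfac _ 0 (by rw [hinv, map_zero]), map_zero]
            map_add' := fun a b => by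
              rw [← map_add]; exact hfac _ _ (by rw [map_add, hinv, hinv, hinv])
            commutes' := fun r => by
              rw [hfac _ (algebraMap K _ r) (by rw [hinv, AlgHom.commutes]), AlgHom.commutes] },
    fun i => ?_, fun a => ?_⟩
  · exact (hfac _ _ (hinv _)).trans (hθe i)
  · exact (hfac _ _ (hinv _)).trans (hθy a)

end AlgebraHoms

section MatrixReps

variable {K Q} {S : Type*} [CommRing S] {n : Type*} [Fintype n] [DecidableEq n]

/-- The diagonal idempotent projecting onto the coordinates lying over the vertex `i`. -/
def vertexProj (S : Type*) [CommRing S] (v : n → Q.V) (i : Q.V) : Matrix n n S :=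
  Matrix.diagonal fun u => if v u = i then 1 else 0

theorem vertexProj_mul_self (v : n → Q.V) (i : Q.V) :
    vertexProj S v i * vertexProj S v i = vertexProj S v i := by
  rw [vertexProj, Matrix.diagonal_mul_diagonal]
  congr 1
  funext u
  split_ifs <;> simp

theorem vertexProj_mul_of_ne (v : n → Q.V) {i j : Q.V} (h : i ≠ j) :
    vertexProj S v i * vertexProj S v j = 0 := by
  rw [vertexProj, vertexProj, Matrix.diagonal_mul_diagonal, ← Matrix.diagonal_zero]
  congr 1
  funext u
  by_cases hu : v u = i <;> simp [hu, h]

omit [Fintype n] in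
theorem sum_vertexProj (v : n → Q.V) : ∑ i, vertexProj S v i = 1 := by
  ext p q
  rw [Matrix.sum_apply]
  by_cases h : p = q
  · subst h; simp [vertexProj]
  · simp [vertexProj, h]

theorem vertexProj_mul_eq_iff {v : n → Q.V} {i : Q.V} {m : Matrix n n S} :
    vertexProj S v i * m = m ↔ ∀ p q, m p q ≠ 0 → v p = i := by
  rw [← Matrix.ext_iff]
  refine forall₂_congr fun p q => ?_
  rw [vertexProj, Matrix.diagonal_mul]
  by_cases h : v p = i <;> simp [h, eq_comm]

theorem mul_vertexProj_eq_iff {v : n → Q.V} {i : Q.V} {m : Matrix n n S} :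
    m * vertexProj S v i = m ↔ ∀ p q, m p q ≠ 0 → v q = i := by
  rw [← Matrix.ext_iff]
  refine forall₂_congr fun p q => ?_
  rw [vertexProj, Matrix.mul_diagonal]
  by_cases h : v q = i <;> simp [h, eq_comm]

variable {A : Type} [Ring A] [Algebra K A] {φ : PathAlgebra K Q →ₐ[K] A}

theorem exists_algHom_matrix [Algebra K S] (hadm : IsAdmissiblePresentation K Q φ)
    (v : n → Q.V) (y : Q.A → Matrix n n S)
    (htgt : ∀ a, vertexProj S v (Q.tgt a) * y a = y a)
    (hsrc : ∀ a, y a * vertexProj S v (Q.src a) = y a)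
    (hrel : ∀ (c : QPath Q →₀ K) (i j : Q.V), IsRelationData K Q c i j →
      φ (relElem K Q c) = 0 → relSum y c = 0) :
    ∃ ρ : A →ₐ[K] Matrix n n S, (∀ i, ρ (φ (vertexElem K Q i)) = vertexProj S v i) ∧
      ∀ a, ρ (φ (arrowElem K Q a)) = y a :=
  exists_algHom_of_relations hadm _ y (vertexProj_mul_self v)
    (fun _ _ h => vertexProj_mul_of_ne v h) (sum_vertexProj v) htgt hsrc hrel

variable {d : Q.V → ℕ}

theorem blockCompatible_iff {x : RepSpace K Q d} : BlockCompatible K Q d x ↔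
    ∀ a, vertexProj K Sigma.fst (Q.tgt a) * x a = x a ∧
      x a * vertexProj K Sigma.fst (Q.src a) = x a := by
  refine forall_congr' fun a => ?_
  rw [vertexProj_mul_eq_iff, mul_vertexProj_eq_iff]
  exact ⟨fun h => ⟨fun p q hpq => (h p q hpq).1, fun p q hpq => (h p q hpq).2⟩,
    fun h p q hpq => ⟨h.1 p q hpq, h.2 p q hpq⟩⟩

theorem exists_algHom_of_mem_repSet (hadm : IsAdmissiblePresentation K Q φ)
    {x : RepSpace K Q d} (hx : x ∈ RepSet K Q φ d) :
    ∃ ρ : A →ₐ[K] Matrix (RepIx Q d) (RepIx Q d) K,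
      (∀ i, ρ (φ (vertexElem K Q i)) = vertexProj K Sigma.fst i) ∧
      ∀ a, ρ (φ (arrowElem K Q a)) = x a :=
  exists_algHom_matrix hadm _ x (fun a => (blockCompatible_iff.1 hx.1 a).1)
    (fun a => (blockCompatible_iff.1 hx.1 a).2) hx.2

variable (K Q) in
theorem vertexElem_tgt_mul (a : Q.A) :
    vertexElem K Q (Q.tgt a) * arrowElem K Q a = arrowElem K Q a := by
  rw [vertexElem, arrowElem, ← map_mul]; exact RingQuot.mkAlgHom_rel K (PathRel.tgt_mul a)

variable (K Q) in
theorem arrowElem_mul_src (a : Q.A) :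
    arrowElem K Q a * vertexElem K Q (Q.src a) = arrowElem K Q a := by
  rw [vertexElem, arrowElem, ← map_mul]; exact RingQuot.mkAlgHom_rel K (PathRel.mul_src a)

variable (K Q) in
theorem vertexElem_mul_of_ne {i j : Q.V} (h : i ≠ j) :
    vertexElem K Q i * vertexElem K Q j = 0 := by
  rw [vertexElem, vertexElem, ← map_mul, ← map_zero (RingQuot.mkAlgHom K (PathRel K Q))]
  exact RingQuot.mkAlgHom_rel K (PathRel.orth i j h)

variable (K Q) in
theorem sum_vertexElem : ∑ i, vertexElem K Q i = 1 := by
  simp only [vertexElem]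
  rw [← map_sum, ← map_one (RingQuot.mkAlgHom K (PathRel K Q))]
  exact RingQuot.mkAlgHom_rel K PathRel.sum_one

theorem mem_repSet_of_algHom (ρ : A →ₐ[K] Matrix (RepIx Q d) (RepIx Q d) K)
    (hρ : ∀ i, ρ (φ (vertexElem K Q i)) = vertexProj K Sigma.fst i) :
    (fun a => ρ (φ (arrowElem K Q a))) ∈ RepSet K Q φ d := by
  refine ⟨blockCompatible_iff.2 fun a => ⟨?_, ?_⟩, fun c i j _ h0 => ?_⟩
  · rw [← hρ, ← map_mul, ← map_mul, vertexElem_tgt_mul]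
  · rw [← hρ, ← map_mul, ← map_mul, arrowElem_mul_src]
  · have := map_relSum (ρ.comp φ) (arrowElem K Q) c
    exact this.symm.trans (by
      rw [AlgHom.comp_apply]
      exact (congrArg ρ h0).trans (map_zero ρ))

/-- An induction principle for the quotient of a path algebra. -/
theorem mem_of_generators (hφ : Function.Surjective φ) (P : Subalgebra K A)
    (hv : ∀ i, φ (vertexElem K Q i) ∈ P) (ha : ∀ a, φ (arrowElem K Q a) ∈ P) (z : A) : z ∈ P := by
  obtain ⟨w, rfl⟩ := hφ z
  obtain ⟨f, rfl⟩ := RingQuot.mkAlgHom_surjective K (PathRel K Q) w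
  induction f using FreeAlgebra.induction with
  | grade0 r => rw [AlgHom.commutes, AlgHom.commutes]; exact P.algebraMap_mem r
  | grade1 x => cases x with
    | inl i => exact hv i
    | inr a => exact ha a
  | mul a b ha hb => rw [map_mul, map_mul]; exact P.mul_mem ha hb
  | add a b ha hb => rw [map_add, map_add]; exact P.add_mem ha hb

end MatrixReps

section Orbits

open Matrix (blockDiagonal' blockDiag' blockDiagonal'_apply' blockDiagonal'_mul blockDiagonal'_one
  blockDiagonal'_injective blockDiag'_apply diagonal_mul mul_diagonal)

variable {K Q} {d : Q.V → ℕ}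

theorem blockDiag_eq_blockDiagonal' (g : (i : Q.V) → GL (Fin (d i)) K) :
    blockDiag K Q g = blockDiagonal' fun i => (g i : Matrix (Fin (d i)) (Fin (d i)) K) := by
  ext ⟨i, k⟩ ⟨j, l⟩
  rw [blockDiagonal'_apply', blockDiag]
  by_cases h : i = j
  · subst h; simp
  · simp [h, Ne.symm h]

theorem blockDiag_mul_inv (g : (i : Q.V) → GL (Fin (d i)) K) :
    blockDiag K Q g * blockDiag K Q (fun i => (g i)⁻¹) = 1 := by
  rw [blockDiag_eq_blockDiagonal', blockDiag_eq_blockDiagonal', ← blockDiagonal'_mul]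
  simp only [Units.mul_inv]
  exact blockDiagonal'_one

theorem blockDiag_inv_mul (g : (i : Q.V) → GL (Fin (d i)) K) :
    blockDiag K Q (fun i => (g i)⁻¹) * blockDiag K Q g = 1 := by
  rw [blockDiag_eq_blockDiagonal', blockDiag_eq_blockDiagonal', ← blockDiagonal'_mul]
  simp only [Units.inv_mul]
  exact blockDiagonal'_one

theorem vertexProj_mul_blockDiag (g : (i : Q.V) → GL (Fin (d i)) K) (i : Q.V) :
    vertexProj K Sigma.fst i * blockDiag K Q g = blockDiag K Q g * vertexProj K Sigma.fst i := by
  ext p q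
  rw [vertexProj, diagonal_mul, mul_diagonal, blockDiag]
  by_cases h : q.1 = p.1 <;> simp [h]

theorem eq_blockDiagonal'_of_commute {G : Matrix (RepIx Q d) (RepIx Q d) K}
    (hG : ∀ i, vertexProj K Sigma.fst i * G = G * vertexProj K Sigma.fst i) :
    G = blockDiagonal' (blockDiag' G) := by
  ext ⟨i, k⟩ ⟨j, l⟩
  rw [blockDiagonal'_apply']
  by_cases h : i = j
  · subst h; simp [blockDiag'_apply]
  · rw [dif_neg h]
    have := congrFun (congrFun (hG i) ⟨i, k⟩) ⟨j, l⟩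
    rw [vertexProj, diagonal_mul, mul_diagonal] at this
    simpa [Ne.symm h] using this

theorem exists_blockDiag_eq {G G' : Matrix (RepIx Q d) (RepIx Q d) K}
    (hG : ∀ i, vertexProj K Sigma.fst i * G = G * vertexProj K Sigma.fst i)
    (h : G * G' = 1) (h' : G' * G = 1) :
    ∃ g : (i : Q.V) → GL (Fin (d i)) K, blockDiag K Q g = G ∧
      blockDiag K Q (fun i => (g i)⁻¹) = G' := by
  have hG' : ∀ i, vertexProj K Sigma.fst i * G' = G' * vertexProj K Sigma.fst i := fun i =>
    calc vertexProj K Sigma.fst i * G'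
        = G' * (G * vertexProj K Sigma.fst i) * G' := by rw [← mul_assoc, h', one_mul]
      _ = _ := by rw [← hG, mul_assoc, mul_assoc, h, mul_one]
  have key : ∀ {C D : Matrix (RepIx Q d) (RepIx Q d) K},
      (∀ i, vertexProj K Sigma.fst i * C = C * vertexProj K Sigma.fst i) →
      (∀ i, vertexProj K Sigma.fst i * D = D * vertexProj K Sigma.fst i) → C * D = 1 →
      ∀ i, blockDiag' C i * blockDiag' D i = 1 := by
    intro C D hC hD hCD i
    have e : blockDiagonal' (fun i => blockDiag' C i * blockDiag' D i) =
        (1 : Matrix (RepIx Q d) (RepIx Q d) K) := by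
      rw [blockDiagonal'_mul, ← eq_blockDiagonal'_of_commute hC, ← eq_blockDiagonal'_of_commute hD,
        hCD]
    rw [← blockDiagonal'_one] at e
    exact congrFun (blockDiagonal'_injective e) i
  refine ⟨fun i => ⟨blockDiag' G i, blockDiag' G' i, key hG hG' h i, key hG' hG h' i⟩, ?_, ?_⟩
  · rw [blockDiag_eq_blockDiagonal']
    exact (eq_blockDiagonal'_of_commute hG).symm
  · rw [blockDiag_eq_blockDiagonal']
    exact (eq_blockDiagonal'_of_commute hG').symm

variable {A : Type} [Ring A] [Algebra K A] {φ : PathAlgebra K Q →ₐ[K] A}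

theorem repOrbit_subset_repSet {x : RepSpace K Q d} (hx : x ∈ RepSet K Q φ d) :
    repOrbit K Q d x ⊆ RepSet K Q φ d := by
  rintro y ⟨g, hg⟩
  have hy : y = fun a => blockDiag K Q g * x a * blockDiag K Q (fun i => (g i)⁻¹) := funext hg
  refine ⟨blockCompatible_iff.2 fun a => ?_, fun c i j hc h0 => ?_⟩
  · have := blockCompatible_iff.1 hx.1 a
    constructor
    · rw [hg, ← mul_assoc, ← mul_assoc, vertexProj_mul_blockDiag, mul_assoc (blockDiag K Q g),
        this.1]
    · rw [hg, mul_assoc, ← vertexProj_mul_blockDiag, ← mul_assoc, mul_assoc (blockDiag K Q g),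
        this.2]
  · rw [hy]
    refine (relSum_conj x (blockDiag_inv_mul g) (blockDiag_mul_inv g) c).trans ?_
    have : relSum x c = 0 := hx.2 c i j hc h0
    rw [this]; simp

end Orbits

section ZariskiBasis

open TopologicalSpace

variable {K Q} {d : Q.V → ℕ}

/-- The coordinates of a point of the representation space. -/
def repCoords (x : RepSpace K Q d) : Q.A × RepIx Q d × RepIx Q d → K :=
  fun u => x u.1 u.2.1 u.2.2

theorem isTopologicalBasis_repTopology : @IsTopologicalBasis _ (repTopology K Q d)
    {U | ∃ f : MvPolynomial (Q.A × RepIx Q d × RepIx Q d) K,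
      U = {x | MvPolynomial.eval (repCoords x) f ≠ 0}} := by
  let _ := zariskiTopology (Q.A × RepIx Q d × RepIx Q d) K
  have h := isTopologicalBasis_of_subbasis_of_inter (r := {U | ∃ f : MvPolynomial _ K,
    U = {x : Q.A × RepIx Q d × RepIx Q d → K | MvPolynomial.eval x f ≠ 0}}) rfl (by
      rintro _ ⟨f, rfl⟩ _ ⟨g, rfl⟩
      refine ⟨f * g, ?_⟩
      ext x
      simp)
  have huniv : Set.univ ∈ {U | ∃ f : MvPolynomial _ K,
      U = {x : Q.A × RepIx Q d × RepIx Q d → K | MvPolynomial.eval x f ≠ 0}} := ⟨1, by simp⟩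
  rw [Set.insert_eq_of_mem huniv] at h
  convert! h.induced (repCoords (K := K) (Q := Q) (d := d)) using 1
  ext U
  constructor
  · rintro ⟨f, rfl⟩; exact ⟨_, ⟨f, rfl⟩, rfl⟩
  · rintro ⟨_, ⟨f, rfl⟩, rfl⟩; exact ⟨f, rfl⟩

theorem exists_common_nonvanishing {X : Set (RepSpace K Q d)}
    (hX : @IsIrreducible _ (repTopology K Q d) X)
    {f g : MvPolynomial (Q.A × RepIx Q d × RepIx Q d) K}
    (hf : ∃ x ∈ X, MvPolynomial.eval (repCoords x) f ≠ 0)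
    (hg : ∃ x ∈ X, MvPolynomial.eval (repCoords x) g ≠ 0) :
    ∃ x ∈ X, MvPolynomial.eval (repCoords x) (f * g) ≠ 0 := by
  let _ := repTopology K Q d
  have hopen : ∀ f : MvPolynomial (Q.A × RepIx Q d × RepIx Q d) K,
      IsOpen {x | MvPolynomial.eval (repCoords x) f ≠ 0} := fun f =>
    isTopologicalBasis_repTopology.isOpen ⟨f, rfl⟩
  obtain ⟨x, hx, h1, h2⟩ := hX.isPreirreducible _ _ (hopen f) (hopen g)
    (by obtain ⟨x, h⟩ := hf; exact ⟨x, h⟩) (by obtain ⟨x, h⟩ := hg; exact ⟨x, h⟩)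
  exact ⟨x, hx, by rw [map_mul]; exact mul_ne_zero h1 h2⟩

end ZariskiBasis

section Extensions

variable {K Q} {A : Type} [Ring A] [Algebra K A] {φ : PathAlgebra K Q →ₐ[K] A}
  {M N : Type*} [AddCommGroup M] [Module K M] [Module A M] [IsScalarTower K A M]
  [AddCommGroup N] [Module K N] [Module A N] [IsScalarTower K A N]

theorem exists_linearMap_of_generators (hφ : Function.Surjective φ) (f : M →ₗ[K] N)
    (hv : ∀ i m, f (φ (vertexElem K Q i) • m) = φ (vertexElem K Q i) • f m)
    (ha : ∀ a m, f (φ (arrowElem K Q a) • m) = φ (arrowElem K Q a) • f m) :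
    ∃ f' : M →ₗ[A] N, ∀ m, f' m = f m := by
  let P : Subalgebra K A :=
    { carrier := {z | ∀ m, f (z • m) = z • f m}
      mul_mem' := fun {a b} h h' m => by rw [mul_smul, h, h', mul_smul]
      add_mem' := fun {a b} h h' m => by rw [add_smul, map_add, h, h', add_smul]
      algebraMap_mem' := fun r m => by rw [algebraMap_smul, map_smul, algebraMap_smul] }
  exact ⟨{ toFun := f, map_add' := map_add f, map_smul' := fun z m =>
    (mem_of_generators hφ P hv ha z : z ∈ P) m }, fun _ => rfl⟩

/-- The module afforded by a matrix representation. -/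
abbrev matrixModule {S : Type*} [CommRing S] [Algebra K S] {n : Type*} [Fintype n] [DecidableEq n]
    (ρ : A →ₐ[K] Matrix n n S) : Module A (n → S) :=
  Module.compHom (n → S) ((Matrix.toLinAlgEquiv' : Matrix n n S ≃ₐ[S] _) : Matrix n n S →+*
    Module.End S (n → S)) |>.compHom (n → S) (ρ : A →+* Matrix n n S)

variable {n : Type} [Fintype n] [DecidableEq n]

/-- The first order deformation of a tuple of matrices in a given direction. -/
def deform (x Z : Q.A → Matrix n n K) (a : Q.A) : Matrix n n (DualNumber K) :=
  Matrix.of fun p q => algebraMap K (DualNumber K) (x a p q) + Z a p q • DualNumber.eps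

theorem exists_commutator_of_rigid (hadm : IsAdmissiblePresentation K Q φ)
    {M : Type} [AddCommGroup M] [Module K M] [Module A M] [IsScalarTower K A M]
    (hM : RigidModule A M) (v : n → Q.V) (x Z : Q.A → Matrix n n K) (ψ : (n → K) ≃ₗ[K] M)
    (hψa : ∀ (a : Q.A) (w : n → K), ψ ((x a).mulVec w) = φ (arrowElem K Q a) • ψ w)
    (hψe : ∀ (i : Q.V) (w : n → K),
      ψ ((vertexProj K v i).mulVec w) = φ (vertexElem K Q i) • ψ w)
    (htgt : ∀ a, vertexProj _ v (Q.tgt a) * deform x Z a = deform x Z a)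
    (hsrc : ∀ a, deform x Z a * vertexProj _ v (Q.src a) = deform x Z a)
    (hrel : ∀ (c : QPath Q →₀ K) (i j : Q.V), IsRelationData K Q c i j →
      φ (relElem K Q c) = 0 → relSum (deform x Z) c = 0) :
    ∃ H : Matrix n n K, (∀ i, vertexProj K v i * H = H * vertexProj K v i) ∧
      ∀ a, Z a = H * x a - x a * H := by
  obtain ⟨ρ, hρe, hρa⟩ := exists_algHom_matrix hadm v (deform x Z) htgt hsrc hrel
  let _ : Module A (n → DualNumber K) := matrixModule ρ
  have hsm : ∀ (z : A) (w : n → DualNumber K), z • w = (ρ z).mulVec w := fun _ _ => rfl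
  have : IsScalarTower K A (n → DualNumber K) := ⟨fun r z w => by
    rw [hsm, hsm, map_smul, Matrix.smul_mulVec]⟩
  have fstv : ∀ i (w : n → DualNumber K),
      (fun p => ((vertexProj (DualNumber K) v i).mulVec w p).fst) =
        (vertexProj K v i).mulVec fun p => (w p).fst := by
    intro i w
    funext p
    simp only [vertexProj, Matrix.mulVec_diagonal]
    split_ifs <;> simp
  have sndv : ∀ i (w : n → DualNumber K),
      (fun p => ((vertexProj (DualNumber K) v i).mulVec w p).snd) =
        (vertexProj K v i).mulVec fun p => (w p).snd := by
    intro i w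
    funext p
    simp only [vertexProj, Matrix.mulVec_diagonal]
    split_ifs <;> simp
  have fstd : ∀ a (w : n → DualNumber K), (fun p => ((deform x Z a).mulVec w p).fst) =
        (x a).mulVec fun p => (w p).fst := by
    intro a w
    funext p
    simp [deform, Matrix.mulVec, dotProduct, TrivSqZeroExt.algebraMap_eq_inl,
      TrivSqZeroExt.fst_sum]
  have sndd : ∀ a (w : n → DualNumber K), (fun p => ((deform x Z a).mulVec w p).snd) =
        ((x a).mulVec fun p => (w p).snd) + (Z a).mulVec fun p => (w p).fst := by
    intro a w
    funext p
    simp [deform, Matrix.mulVec, dotProduct, TrivSqZeroExt.algebraMap_eq_inl,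
      TrivSqZeroExt.snd_sum, Finset.sum_add_distrib, mul_comm, add_comm]
  let inr : (n → K) →ₗ[K] (n → DualNumber K) :=
    { toFun := fun w p => TrivSqZeroExt.inr (w p)
      map_add' := fun w w' => by funext p; simp [add_smul]
      map_smul' := fun r w => by funext p; simp [mul_smul] }
  have ext' : ∀ w w' : n → DualNumber K, (fun p => (w p).fst) = (fun p => (w' p).fst) →
      (fun p => (w p).snd) = (fun p => (w' p).snd) → w = w' := fun w w' h h' =>
    funext fun p => TrivSqZeroExt.ext (congrFun h p) (congrFun h' p)
  have inr1 : ∀ w : n → K, (fun p => (inr w p).fst) = 0 := fun w => rfl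
  have inr2 : ∀ w : n → K, (fun p => (inr w p).snd) = w := fun w => rfl
  let fst : (n → DualNumber K) →ₗ[K] (n → K) :=
    { toFun := fun w p => (w p).fst
      map_add' := fun w w' => by funext p; simp
      map_smul' := fun r w => by funext p; simp }
  have fsta : ∀ w, fst w = fun p => (w p).fst := fun _ => rfl
  obtain ⟨f, hf⟩ := exists_linearMap_of_generators (φ := φ) hadm.1 (inr ∘ₗ ψ.symm.toLinearMap)
    (by
      intro i m
      obtain ⟨w, rfl⟩ := ψ.surjective m
      rw [← hψe, hsm, hρe]
      apply ext'
      · rw [fstv]; simp [inr1]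
      · rw [sndv]; simp [inr2])
    (by
      intro a m
      obtain ⟨w, rfl⟩ := ψ.surjective m
      rw [← hψa, hsm, hρa]
      apply ext'
      · rw [fstd]; simp [inr1]
      · rw [sndd]; simp [inr2, inr1])
  obtain ⟨g, hg⟩ := exists_linearMap_of_generators (φ := φ) hadm.1 (ψ.toLinearMap ∘ₗ fst)
    (by
      intro i w
      simp only [LinearMap.comp_apply, LinearEquiv.coe_coe]
      rw [← hψe, hsm, hρe, fsta, fsta, fstv])
    (by
      intro a w
      simp only [LinearMap.comp_apply, LinearEquiv.coe_coe]
      rw [← hψa, hsm, hρa, fsta, fsta, fstd])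
  obtain ⟨s, hs⟩ := hM (n → DualNumber K) f g
    (by
      intro m m' h
      rw [hf, hf] at h
      have := congrArg (fun w p => (w p).snd) h
      simp only [LinearMap.comp_apply, inr2] at this
      exact ψ.symm.injective this)
    (by
      intro m
      refine ⟨fun p => TrivSqZeroExt.inl (ψ.symm m p), ?_⟩
      rw [hg]
      simp [fsta])
    (by
      ext w
      rw [LinearMap.mem_range, LinearMap.mem_ker, hg]
      constructor
      · rintro ⟨m, rfl⟩
        rw [hf]
        simp [fsta, inr1]
      · intro h
        refine ⟨ψ fun p => (w p).snd, ?_⟩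
        rw [hf]
        have h0 : fst w = 0 := by simpa using h
        apply ext'
        · rw [← fsta w, h0]; simp [inr1]
        · simp [inr2])
  have hsK : ∀ (r : K) m, s (r • m) = r • s m := fun r m => by
    rw [← algebraMap_smul A r m, map_smul, algebraMap_smul]
  let h : (n → K) →ₗ[K] (n → K) :=
    { toFun := fun w p => (s (ψ w) p).snd
      map_add' := fun w w' => by funext p; simp
      map_smul' := fun r w => by funext p; simp [hsK] }
  have hH : ∀ w, (LinearMap.toMatrix' h).mulVec w = fun p => (s (ψ w) p).snd := fun w => by
    rw [LinearMap.toMatrix'_mulVec]; rfl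
  have hfst : ∀ w, (fun p => (s (ψ w) p).fst) = w := fun w => by
    have := LinearMap.congr_fun hs (ψ w)
    rw [LinearMap.comp_apply, hg] at this
    exact ψ.injective this
  refine ⟨LinearMap.toMatrix' h, fun i => ?_, fun a => ?_⟩
  · apply Matrix.ext_of_mulVec_single
    intro p
    rw [← Matrix.mulVec_mulVec, ← Matrix.mulVec_mulVec, hH, hH, hψe, map_smul, hsm, hρe, sndv]
  · apply Matrix.ext_of_mulVec_single
    intro p
    rw [Matrix.sub_mulVec, ← Matrix.mulVec_mulVec, ← Matrix.mulVec_mulVec, hH, hH, hψa, map_smul,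
      hsm, hρa, sndd, hfst, add_sub_cancel_left]

end Extensions

section Density

variable {K Q} {n : Type} [Fintype n] [DecidableEq n]

theorem hasArc_of_commutator [Infinite K] {I : Ideal (MvPolynomial (Q.A × n × n) K)}
    (x : Q.A → Matrix n n K) (H : Matrix n n K)
    (hI : ∀ f ∈ I, ∀ (t : K) (G : Matrix n n K), (1 + t • H) * G = 1 →
      MvPolynomial.eval (fun u => ((1 + t • H) * x u.1 * G - x u.1) u.2.1 u.2.2) f = 0) :
    MvPolynomial.HasArc I fun u => (H * x u.1 - x u.1 * H) u.2.1 u.2.2 := by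
  let gp : Matrix n n (Polynomial K) := 1 + (Polynomial.X : Polynomial K) • H.map Polynomial.C
  have gp0 : ∀ t : K, (Polynomial.aeval (R := K) t).mapMatrix gp = 1 + t • H := by
    intro t
    ext p q
    by_cases h : p = q <;> simp [gp, h] <;> ring
  have hD0 : Polynomial.aeval (R := K) (0 : K) gp.det = 1 := by
    rw [AlgHom.map_det, gp0]; simp
  have hDne : gp.det ≠ 0 := fun h => by rw [h] at hD0; simp at hD0
  let S := Localization.Away gp.det
  have hle : Submonoid.powers gp.det ≤ nonZeroDivisors (Polynomial K) :=
    powers_le_nonZeroDivisors_of_noZeroDivisors hDne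
  have hdom : IsDomain S := IsLocalization.isDomain_localization hle
  have hinj : Function.Injective (algebraMap (Polynomial K) S) := IsLocalization.injective S hle
  let ev : ∀ t : K, Polynomial.aeval (R := K) t gp.det ≠ 0 → S →ₐ[K] K := fun t ht =>
    IsLocalization.liftAlgHom (M := Submonoid.powers gp.det) (f := Polynomial.aeval t)
      (by
        rintro ⟨_, e, rfl⟩
        simpa using (IsUnit.mk0 _ ht).pow e)
  have evX : ∀ t ht p, ev t ht (algebraMap (Polynomial K) S p) = Polynomial.aeval t p :=
    fun t ht p => IsLocalization.lift_eq _ _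
  let s : S := algebraMap (Polynomial K) S Polynomial.X
  let gS : Matrix n n S := gp.map (algebraMap (Polynomial K) S)
  have hgS : gS * gS⁻¹ = 1 := by
    apply Matrix.mul_nonsing_inv
    have : gS.det = algebraMap (Polynomial K) S gp.det :=
      (RingHom.map_det (algebraMap (Polynomial K) S) gp).symm
    rw [this]
    exact IsLocalization.Away.algebraMap_isUnit _
  have evg : ∀ t ht, (ev t ht).mapMatrix gS = 1 + t • H := fun t ht => by
    rw [← gp0]
    ext p q
    exact evX t ht _
  have evg' : ∀ t ht, (1 + t • H) * (ev t ht).mapMatrix gS⁻¹ = 1 := fun t ht => by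
    rw [← evg t ht, ← map_mul, hgS, map_one]
  let u : Q.A × n × n → S := fun u =>
    ((H * x u.1 - x u.1 * H).map (algebraMap K S) * gS⁻¹) u.2.1 u.2.2
  have evu : ∀ t ht w, ev t ht (u w) =
      ((H * x w.1 - x w.1 * H) * (ev t ht).mapMatrix gS⁻¹) w.2.1 w.2.2 := fun t ht w => by
    simp only [u, Matrix.mul_apply, map_sum, map_mul, Matrix.map_apply, AlgHom.commutes,
      AlgHom.mapMatrix_apply]
    rfl
  have h0 : Polynomial.aeval (R := K) (0 : K) gp.det ≠ 0 := by rw [hD0]; exact one_ne_zero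
  refine ⟨S, inferInstance, hdom, inferInstance, s, ev 0 h0, u, ?_, ?_, ?_, ?_⟩
  · intro h
    exact Polynomial.X_ne_zero (hinj (h.trans (map_zero _).symm))
  · rw [evX _ h0]; simp
  · intro w
    have := evg' 0 h0
    rw [zero_smul, add_zero, one_mul] at this
    rw [evu _ h0, this, mul_one]
  · intro f hf
    obtain ⟨⟨p, m⟩, hp⟩ := IsLocalization.surj (Submonoid.powers gp.det)
      (MvPolynomial.aeval (R := K) (fun i => s * u i) f)
    have hunit : IsUnit (algebraMap (Polynomial K) S m) := IsLocalization.map_units S m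
    have hpz : gp.det * p = 0 := by
      apply Polynomial.funext
      intro t
      rw [Polynomial.eval_mul, Polynomial.eval_zero]
      by_cases ht : Polynomial.eval t gp.det = 0
      · rw [ht, zero_mul]
      have ht' : Polynomial.aeval (R := K) t gp.det ≠ 0 := by
        rwa [Polynomial.coe_aeval_eq_eval]
      have e := congrArg (ev t ht') hp
      have hz : ev t ht' (MvPolynomial.aeval (R := K) (fun i => s * u i) f) = 0 := by
        rw [← hI f hf t _ (evg' t ht'), MvPolynomial.comp_aeval_apply,
          ← MvPolynomial.coe_aeval_eq_eval, RingHom.coe_coe]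
        congr 2
        funext w
        rw [map_mul, evu _ ht', evX _ ht', Polynomial.aeval_X]
        set G := (ev t ht').mapMatrix gS⁻¹
        have : (1 + t • H) * x w.1 * G - x w.1 = t • ((H * x w.1 - x w.1 * H) * G) := by
          have e1 : (1 + t • H) * x w.1 = x w.1 * (1 + t • H) + t • (H * x w.1 - x w.1 * H) := by
            simp only [add_mul, mul_add, one_mul, mul_one, smul_mul_assoc, mul_smul_comm, smul_sub]
            abel
          rw [e1, add_mul, mul_assoc, evg' t ht', mul_one, add_sub_cancel_left, smul_mul_assoc]
        rw [this]; rfl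
      rw [map_mul, hz, zero_mul, evX _ ht', Polynomial.coe_aeval_eq_eval] at e
      rw [← e, mul_zero]
    have hp0 : p = 0 := (mul_eq_zero.1 hpz).resolve_left hDne
    simp only [hp0, map_zero] at hp
    exact (hunit.mul_left_eq_zero).1 hp

end Density

section Density

variable {K Q} {n : Type} [Fintype n] [DecidableEq n]
  {A : Type} [Ring A] [Algebra K A] {φ : PathAlgebra K Q →ₐ[K] A}

/-- A tuple of matrices displaced from `x` by the coordinates `w`. -/
def displace {S : Type*} [CommRing S] [Algebra K S] (x : Q.A → Matrix n n K)
    (w : Q.A × n × n → S) (a : Q.A) : Matrix n n S :=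
  Matrix.of fun p q => algebraMap K S (x a p q) + w (a, p, q)

theorem mapMatrix_displace {S S' : Type*} [CommRing S] [Algebra K S] [CommRing S'] [Algebra K S']
    (f : S →ₐ[K] S') (x : Q.A → Matrix n n K) (w : Q.A × n × n → S) (a : Q.A) :
    f.mapMatrix (displace x w a) = displace x (fun u => f (w u)) a := by
  ext p q
  simp [displace]

/-- The equations of the representation variety in coordinates centred at `x`. -/
def deformIdeal (φ : PathAlgebra K Q →ₐ[K] A) (v : n → Q.V) (x : Q.A → Matrix n n K) :
    Ideal (MvPolynomial (Q.A × n × n) K) :=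
  Ideal.span ({f | ∃ a p q, ¬(v p = Q.tgt a ∧ v q = Q.src a) ∧ f = MvPolynomial.X (a, p, q)} ∪
    {f | ∃ (c : QPath Q →₀ K) (i j : Q.V) (p q : n), IsRelationData K Q c i j ∧
      φ (relElem K Q c) = 0 ∧ f = relSum (displace x MvPolynomial.X) c p q})

theorem aeval_deformIdeal_iff {S : Type*} [CommRing S] [Algebra K S] (v : n → Q.V)
    (x : Q.A → Matrix n n K) (w : Q.A × n × n → S) :
    (∀ f ∈ deformIdeal φ v x, MvPolynomial.aeval w f = 0) ↔
      (∀ a p q, ¬(v p = Q.tgt a ∧ v q = Q.src a) → w (a, p, q) = 0) ∧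
      ∀ (c : QPath Q →₀ K) (i j : Q.V), IsRelationData K Q c i j → φ (relElem K Q c) = 0 →
        relSum (displace x w) c = 0 := by
  have key : ∀ (c : QPath Q →₀ K) p q, MvPolynomial.aeval w
      (relSum (displace x (MvPolynomial.X (R := K))) c p q) = relSum (displace x w) c p q := by
    intro c p q
    have := map_relSum (MvPolynomial.aeval (R := K) w).mapMatrix (displace x MvPolynomial.X) c
    simp only [mapMatrix_displace, MvPolynomial.aeval_X] at this
    exact congrFun (congrFun this p) q
  have hker : (∀ f ∈ deformIdeal φ v x, MvPolynomial.aeval w f = 0) ↔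
      deformIdeal φ v x ≤ RingHom.ker (MvPolynomial.aeval (R := K) w) := Iff.rfl
  rw [hker, deformIdeal, Ideal.span_le, Set.union_subset_iff]
  refine and_congr ⟨fun h a p q hpq => ?_, ?_⟩ ⟨fun h c i j hc h0 => ?_, ?_⟩
  · simpa using h ⟨a, p, q, hpq, rfl⟩
  · rintro h _ ⟨a, p, q, hpq, rfl⟩
    simpa using h a p q hpq
  · ext p q
    rw [← key]
    exact h ⟨c, i, j, p, q, hc, h0, rfl⟩
  · rintro h _ ⟨c, i, j, p, q, hc, h0, rfl⟩
    rw [SetLike.mem_coe, RingHom.mem_ker]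
    exact (key c p q).trans (by rw [h c i j hc h0]; rfl)

variable {d : Q.V → ℕ}

theorem aeval_deformIdeal_of_mem {x y : RepSpace K Q d} (hx : x ∈ RepSet K Q φ d)
    (hy : y ∈ RepSet K Q φ d) :
    ∀ f ∈ deformIdeal φ Sigma.fst x, MvPolynomial.eval (repCoords y - repCoords x) f = 0 := by
  have := (aeval_deformIdeal_iff (φ := φ) Sigma.fst x (repCoords y - repCoords x)).2
    ⟨fun a p q hpq => ?_, fun c i j hc h0 => ?_⟩
  · simpa [MvPolynomial.coe_aeval_eq_eval] using this
  · have e1 : x a p q = 0 := by by_contra h; exact hpq (hx.1 a p q h)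
    have e2 : y a p q = 0 := by by_contra h; exact hpq (hy.1 a p q h)
    simp [repCoords, e1, e2]
  · have : displace x (repCoords y - repCoords x) = y := by
      funext a
      ext p q
      simp [displace, repCoords]
    rw [this]
    exact hy.2 c i j hc h0

theorem coeff_zero_of_mem_deformIdeal {x : RepSpace K Q d} (hx : x ∈ RepSet K Q φ d)
    {f : MvPolynomial _ K} (hf : f ∈ deformIdeal φ Sigma.fst x) : MvPolynomial.coeff 0 f = 0 := by
  have := aeval_deformIdeal_of_mem hx hx f hf
  rwa [sub_self, MvPolynomial.eval_zero, MvPolynomial.constantCoeff_eq] at this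

omit [Fintype n] [DecidableEq n] in
theorem deform_eq_displace (x : Q.A → Matrix n n K) (z : Q.A × n × n → K) :
    deform x (fun a => Matrix.of fun p q => z (a, p, q)) =
      displace x fun u => z u • (DualNumber.eps : DualNumber K) := rfl

/-- An affine description of a rigid module: the data relating a point of the representation
space to a module. -/
structure IsRealization (φ : PathAlgebra K Q →ₐ[K] A) (v : n → Q.V) (x : Q.A → Matrix n n K)
    {M : Type*} [AddCommGroup M] [Module K M] [Module A M] (ψ : (n → K) ≃ₗ[K] M) : Prop where
  arrow : ∀ (a : Q.A) (w : n → K), ψ ((x a).mulVec w) = φ (arrowElem K Q a) • ψ w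
  vertex : ∀ (i : Q.V) (w : n → K),
    ψ ((vertexProj K v i).mulVec w) = φ (vertexElem K Q i) • ψ w

theorem eval_eq_zero_of_orbit [Infinite K] (hadm : IsAdmissiblePresentation K Q φ)
    {M : Type} [AddCommGroup M] [Module K M] [Module A M] [IsScalarTower K A M]
    (hM : RigidModule A M) (hirr : @IsIrreducible _ (repTopology K Q d) (RepSet K Q φ d))
    {x : RepSpace K Q d} (hx : x ∈ RepSet K Q φ d) {ψ : (RepIx Q d → K) ≃ₗ[K] M}
    (hψ : IsRealization φ Sigma.fst x ψ) {f : MvPolynomial (Q.A × RepIx Q d × RepIx Q d) K}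
    (hf : ∀ y ∈ repOrbit K Q d x, MvPolynomial.eval (repCoords y) f = 0)
    {y : RepSpace K Q d} (hy : y ∈ RepSet K Q φ d) : MvPolynomial.eval (repCoords y) f = 0 := by
  let I : Ideal (MvPolynomial (Q.A × RepIx Q d × RepIx Q d) K) :=
    ⨅ y ∈ repOrbit K Q d x, RingHom.ker (MvPolynomial.eval (repCoords y - repCoords x))
  have hI : ∀ g, g ∈ I ↔
      ∀ y ∈ repOrbit K Q d x, MvPolynomial.eval (repCoords y - repCoords x) g = 0 := by
    intro g; simp [I]
  have hshift : ∀ (z w : Q.A × RepIx Q d × RepIx Q d → K) g, MvPolynomial.eval z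
      (MvPolynomial.aeval (fun u => MvPolynomial.X u + MvPolynomial.C (w u)) g) =
      MvPolynomial.eval (z + w) g := by
    intro z w g
    rw [← RingHom.coe_coe (MvPolynomial.aeval _), ← RingHom.comp_apply]
    congr 1
    ext i <;> simp
  set F := MvPolynomial.aeval (fun u => MvPolynomial.X u + MvPolynomial.C (repCoords x u)) f
    with hF
  have hFI : F ∈ I := (hI F).2 fun y hy => by rw [hF, hshift, sub_add_cancel]; exact hf y hy
  have hJ : deformIdeal φ Sigma.fst x ≤ MvPolynomial.idealOfVars _ K := by
    intro g hg
    rw [← pow_one (MvPolynomial.idealOfVars _ K), MvPolynomial.mem_pow_idealOfVars_iff']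
    intro m hm
    have : m = 0 := by
      rw [← Finsupp.degree_eq_zero_iff]; omega
    rw [this]
    exact coeff_zero_of_mem_deformIdeal hx hg
  have hJI : deformIdeal φ Sigma.fst x ≤ I := fun g hg =>
    (hI g).2 fun y hy => aeval_deformIdeal_of_mem hx (repOrbit_subset_repSet hx hy) g hg
  have harc : ∀ z ∈ MvPolynomial.tangentSpace (deformIdeal φ Sigma.fst x),
      MvPolynomial.HasArc I z := by
    intro z hz
    have hz' : ∀ g ∈ deformIdeal φ Sigma.fst x,
        MvPolynomial.aeval (fun u => z u • (DualNumber.eps : DualNumber K)) g = 0 := fun g hg => by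
      rw [MvPolynomial.aeval_eps_smul, coeff_zero_of_mem_deformIdeal hx hg,
        MvPolynomial.mem_tangentSpace.1 hz g hg]
      simp
    obtain ⟨hb, hrel⟩ := (aeval_deformIdeal_iff _ _ _).1 hz'
    have hblock : ∀ a p q, displace x (fun u => z u • (DualNumber.eps : DualNumber K)) a p q ≠ 0 →
        p.1 = Q.tgt a ∧ q.1 = Q.src a := by
      intro a p q h
      by_contra hpq
      apply h
      have e1 : x a p q = 0 := by by_contra h; exact hpq (hx.1 a p q h)
      have e2 := hb a p q hpq
      simp only [displace, Matrix.of_apply, e1, e2, map_zero, add_zero]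
    obtain ⟨H, hH, hZ⟩ := exists_commutator_of_rigid hadm hM Sigma.fst x
      (fun a => Matrix.of fun p q => z (a, p, q)) ψ hψ.arrow hψ.vertex
      (fun a => by
        rw [deform_eq_displace]
        exact vertexProj_mul_eq_iff.2 fun p q h => (hblock a p q h).1)
      (fun a => by
        rw [deform_eq_displace]
        exact mul_vertexProj_eq_iff.2 fun p q h => (hblock a p q h).2)
      (fun c i j hc h0 => by
        rw [deform_eq_displace]
        exact hrel c i j hc h0)
    have hzeq : z = fun u => (H * x u.1 - x u.1 * H) u.2.1 u.2.2 := by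
      funext u
      rw [← hZ]; rfl
    rw [hzeq]
    refine hasArc_of_commutator x H fun g hg t G hG => ?_
    obtain ⟨γ, h1, h2⟩ := exists_blockDiag_eq (K := K) (Q := Q) (d := d) (G := 1 + t • H) (G' := G)
      (fun i => by rw [mul_add, add_mul, mul_smul_comm, smul_mul_assoc, hH]; simp) hG
      (mul_eq_one_comm.1 hG)
    have := (hI g).1 hg (fun a => (1 + t • H) * x a * G) ⟨γ, fun a => by rw [h1, h2]⟩
    exact this
  obtain ⟨r, hr, hrJ⟩ := MvPolynomial.exists_one_sub_mul_mem hJ hJI harc hFI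
  by_contra hne
  set q := MvPolynomial.aeval
    (fun u => MvPolynomial.X u + MvPolynomial.C (-repCoords x u)) (1 - r)
  obtain ⟨y', hy', hne'⟩ := exists_common_nonvanishing hirr (f := q) (g := f)
    ⟨x, hx, by
      have := hshift (repCoords x) (-repCoords x) (1 - r)
      rw [add_neg_cancel] at this
      refine this.trans_ne ?_
      have hr0 : MvPolynomial.eval 0 r = 0 := by
        have hle : MvPolynomial.idealOfVars _ K ≤
            RingHom.ker (MvPolynomial.eval (0 : Q.A × RepIx Q d × RepIx Q d → K)) := by
          rw [Ideal.span_le]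
          rintro _ ⟨i, rfl⟩
          simp
        exact hle hr
      rw [map_sub, map_one, hr0, sub_zero]
      exact one_ne_zero⟩ ⟨y, hy, hne⟩
  apply hne'
  have e1 := hshift (repCoords y') (-repCoords x) (1 - r)
  have e2 := hshift (repCoords y' - repCoords x) (repCoords x) f
  rw [sub_add_cancel] at e2
  rw [map_mul, ← e2]
  refine (congrArg (· * _) e1).trans ?_
  rw [← sub_eq_add_neg, ← map_mul]
  exact aeval_deformIdeal_of_mem hx hy' _ hrJ

end Density

section Rigidity

variable {A : Type} [Ring A]

/-- Every extension of `X` by `Y` splits. -/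
def ExtensionsSplit (A : Type) [Ring A] (X Y : Type) [AddCommGroup X] [Module A X]
    [AddCommGroup Y] [Module A Y] : Prop :=
  ∀ (E : Type) [AddCommGroup E] [Module A E], ∀ (f : Y →ₗ[A] E) (g : E →ₗ[A] X),
    Function.Injective f → Function.Surjective g → LinearMap.range f = LinearMap.ker g →
    ∃ s : X →ₗ[A] E, g.comp s = LinearMap.id

variable {X Y : Type} [AddCommGroup X] [Module A X] [AddCommGroup Y] [Module A Y]
  {ι : Type} [Fintype ι] [DecidableEq ι]

theorem ExtensionsSplit.pi_left (h : ExtensionsSplit A X Y) : ExtensionsSplit A (ι → X) Y := by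
  intro E _ _ f g hf hg hfg
  have hk : ∀ k, ∃ s : X →ₗ[A] E, ∀ m, g (s m) = Pi.single k m := by
    intro k
    let P : Submodule A E := (LinearMap.range (LinearMap.single A (fun _ : ι => X) k)).comap g
    have hfP : ∀ y, f y ∈ P := fun y => by
      have : f y ∈ LinearMap.ker g := hfg ▸ LinearMap.mem_range_self f y
      rw [Submodule.mem_comap, LinearMap.mem_ker.1 this]
      exact zero_mem _
    have hP : ∀ e : P, Pi.single k (g e.1 k) = g e.1 := by
      rintro ⟨e, m, he⟩
      rw [← he]; simp
    obtain ⟨s, hs⟩ := h P (f.codRestrict P hfP)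
      (LinearMap.proj k ∘ₗ g ∘ₗ P.subtype)
      (fun y y' hy => hf (congrArg Subtype.val hy))
      (fun m => by
        obtain ⟨e, he⟩ := hg (Pi.single k m)
        exact ⟨⟨e, m, he.symm⟩, by simp [he]⟩)
      (by
        ext e
        rw [LinearMap.mem_range, LinearMap.mem_ker]
        constructor
        · rintro ⟨y, rfl⟩
          have : f y ∈ LinearMap.ker g := hfg ▸ LinearMap.mem_range_self f y
          simp [LinearMap.mem_ker.1 this]
        · intro he
          have h0 : e.1 ∈ LinearMap.ker g := by
            rw [LinearMap.mem_ker, ← hP]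
            have : g e.1 k = 0 := he
            rw [this, Pi.single_zero]
          rw [← hfg] at h0
          obtain ⟨y, hy⟩ := h0
          exact ⟨y, Subtype.ext hy⟩)
    refine ⟨P.subtype ∘ₗ s, fun m => ?_⟩
    have := LinearMap.congr_fun hs m
    change g (s m).1 = _
    rw [← hP (s m)]
    exact congrArg _ this
  choose s hs using hk
  refine ⟨∑ k, s k ∘ₗ LinearMap.proj k, LinearMap.ext fun w => ?_⟩
  simp only [LinearMap.comp_apply, LinearMap.sum_apply, map_sum, hs, LinearMap.proj_apply,
    LinearMap.id_apply]
  exact Finset.univ_sum_single w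

omit [Fintype ι] in
theorem ExtensionsSplit.pi_right (h : ExtensionsSplit A X Y) : ExtensionsSplit A X (ι → Y) := by
  intro E _ _ f g hf hg hfg
  have hk : ∀ k, ∃ r : E →ₗ[A] Y, ∀ w, r (f w) = w k := by
    intro k
    let P : Submodule A E := (LinearMap.ker (LinearMap.proj (R := A) (φ := fun _ : ι => Y) k)).map f
    have hP : P ≤ LinearMap.ker g := by
      rw [← hfg]; exact LinearMap.map_le_range
    have hfP : ∀ w, f w ∈ P ↔ w k = 0 := by
      intro w
      constructor
      · rintro ⟨w', hw', he⟩
        rw [← hf he]; exact hw'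
      · exact fun hw => ⟨w, hw, rfl⟩
    let f' : Y →ₗ[A] E ⧸ P := P.mkQ ∘ₗ f ∘ₗ LinearMap.single A (fun _ : ι => Y) k
    have hf' : ∀ w, P.mkQ (f w) = f' (w k) := by
      intro w
      rw [← sub_eq_zero]
      change P.mkQ (f w) - P.mkQ (f (Pi.single k (w k))) = 0
      rw [← map_sub, ← map_sub, Submodule.mkQ_apply, Submodule.Quotient.mk_eq_zero, hfP]
      simp
    have hinj : Function.Injective f' := by
      rw [← LinearMap.ker_eq_bot, LinearMap.ker_eq_bot']
      intro y hy
      have : f (Pi.single k y) ∈ P := (Submodule.Quotient.mk_eq_zero P).1 hy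
      simpa using (hfP _).1 this
    have hex : LinearMap.range f' = LinearMap.ker (P.liftQ g hP) := by
      ext e
      obtain ⟨e, rfl⟩ := P.mkQ_surjective e
      rw [LinearMap.mem_ker, Submodule.mkQ_apply, Submodule.liftQ_apply, ← LinearMap.mem_ker,
        ← hfg]
      constructor
      · rintro ⟨y, hy⟩
        have : f (Pi.single k y) - e ∈ P := (Submodule.Quotient.eq P).1 hy
        have h2 := hP this
        rw [← hfg] at h2
        have := sub_mem (LinearMap.mem_range_self f (Pi.single k y)) h2
        rwa [sub_sub_cancel] at this
      · rintro ⟨w, rfl⟩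
        exact ⟨w k, (hf' w).symm⟩
    have hsurj : Function.Surjective (P.liftQ g hP) := fun m => by
      obtain ⟨e, he⟩ := hg m
      exact ⟨P.mkQ e, he⟩
    have tfae := (LinearMap.exact_iff.2 hex.symm).split_tfae hinj hsurj
    obtain ⟨r, hr⟩ := (tfae.out 0 1).1 (h _ f' _ hinj hsurj hex)
    refine ⟨r ∘ₗ P.mkQ, fun w => ?_⟩
    rw [LinearMap.comp_apply, hf']
    exact LinearMap.congr_fun hr _
  choose r hr using hk
  have tfae := (LinearMap.exact_iff.2 hfg.symm).split_tfae hf hg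
  have hr' : ∃ l, l ∘ₗ f = LinearMap.id :=
    ⟨LinearMap.pi r, LinearMap.ext fun w => funext fun k => hr k w⟩
  exact (tfae.out 0 1).2 hr'

theorem RigidModule.pi (h : RigidModule A X) : RigidModule A (ι → X) :=
  ExtensionsSplit.pi_right (ExtensionsSplit.pi_left h)

end Rigidity

section OrbitClosure

variable {K Q} {d : Q.V → ℕ} {A : Type} [Ring A] [Algebra K A] {φ : PathAlgebra K Q →ₐ[K] A}

theorem closure_orbit_eq_univ {x : RepSpace K Q d}
    (h : ∀ f : MvPolynomial (Q.A × RepIx Q d × RepIx Q d) K,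
      (∀ y ∈ repOrbit K Q d x, MvPolynomial.eval (repCoords y) f = 0) →
      ∀ y ∈ RepSet K Q φ d, MvPolynomial.eval (repCoords y) f = 0)
    (hsub : repOrbit K Q d x ⊆ RepSet K Q φ d) :
    letI : TopologicalSpace (RepSpace K Q d) := repTopology K Q d
    closure {y : ↥(RepSet K Q φ d) | ↑y ∈ repOrbit K Q d x} = Set.univ := by
  let _ : TopologicalSpace (RepSpace K Q d) := repTopology K Q d
  refine Set.eq_univ_of_forall fun y => mem_closure_iff.2 ?_
  rintro _ ⟨U, hU, rfl⟩ hy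
  obtain ⟨_, ⟨f, rfl⟩, hyf, hfU⟩ := isTopologicalBasis_repTopology.exists_subset_of_mem_open hy hU
  by_contra hne
  refine hyf (h f (fun z hz => ?_) y y.2)
  by_contra hz0
  exact hne ⟨⟨z, hsub hz⟩, hfU hz0, hz⟩

theorem isIrreducible_univ_repSet (hirr : @IsIrreducible _ (repTopology K Q d) (RepSet K Q φ d)) :
    letI : TopologicalSpace (RepSpace K Q d) := repTopology K Q d
    IsIrreducible (Set.univ : Set ↥(RepSet K Q φ d)) := by
  let _ : TopologicalSpace (RepSpace K Q d) := repTopology K Q d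
  have := isIrreducible_iff_irreducibleSpace.1 hirr
  exact IrreducibleSpace.isIrreducible_univ _

end OrbitClosure

section Acyclicity

variable {K Q} {A : Type} [Ring A] [Algebra K A] {φ : PathAlgebra K Q →ₐ[K] A}

theorem exists_prod_nonvanishing {d : Q.V → ℕ} {X : Set (RepSpace K Q d)}
    (hX : @IsIrreducible _ (repTopology K Q d) X) {ι : Type*}
    (f : ι → MvPolynomial (Q.A × RepIx Q d × RepIx Q d) K) (F : Finset ι)
    (hf : ∀ k ∈ F, ∃ x ∈ X, MvPolynomial.eval (repCoords x) (f k) ≠ 0) :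
    ∃ x ∈ X, ∀ k ∈ F, MvPolynomial.eval (repCoords x) (f k) ≠ 0 := by
  classical
  suffices h : ∃ x ∈ X, MvPolynomial.eval (repCoords x) (∏ k ∈ F, f k) ≠ 0 by
    obtain ⟨x, hx, h⟩ := h
    rw [map_prod, Finset.prod_ne_zero_iff] at h
    exact ⟨x, hx, h⟩
  induction F using Finset.induction_on with
  | empty =>
    let _ : TopologicalSpace (RepSpace K Q d) := repTopology K Q d
    obtain ⟨x, hx⟩ := hX.nonempty
    exact ⟨x, hx, by simp⟩
  | insert k F hk ih =>
    rw [Finset.prod_insert hk]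
    exact exists_common_nonvanishing hX (hf k (Finset.mem_insert_self k F))
      (ih fun l hl => hf l (Finset.mem_insert_of_mem hl))

theorem prod_arrows_eq_zero_of_not_chain (φ : PathAlgebra K Q →ₐ[K] A) :
    ∀ l : List Q.A, ¬ l.IsChain (fun a b => Q.src a = Q.tgt b) →
      (l.map fun a => φ (arrowElem K Q a)).prod = 0
  | [], h => absurd List.isChain_nil h
  | [a], h => absurd (List.isChain_singleton a) h
  | a :: b :: l, h => by
    by_cases hab : Q.src a = Q.tgt b
    · have hl : ¬ (b :: l).IsChain (fun a b => Q.src a = Q.tgt b) := fun hl =>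
        h (List.isChain_cons_cons.2 ⟨hab, hl⟩)
      rw [List.map_cons, List.prod_cons, prod_arrows_eq_zero_of_not_chain φ _ hl, mul_zero]
    · have : φ (arrowElem K Q a) * φ (arrowElem K Q b) = 0 := by
        rw [← map_mul, ← arrowElem_mul_src K Q a, ← vertexElem_tgt_mul K Q b, mul_assoc,
          ← mul_assoc (vertexElem K Q (Q.src a)), vertexElem_mul_of_ne K Q hab]
        simp
      rw [List.map_cons, List.map_cons, List.prod_cons, List.prod_cons, ← mul_assoc, this,
        zero_mul]

theorem exists_prod_arrows_eq_zero (hadm : IsAdmissiblePresentation K Q φ) :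
    ∃ m : ℕ, ∀ l : List Q.A, m ≤ l.length → (l.map fun a => φ (arrowElem K Q a)).prod = 0 := by
  obtain ⟨-, -, m, hm, h⟩ := hadm
  refine ⟨m, fun l hl => ?_⟩
  by_cases hc : l.IsChain (fun a b => Q.src a = Q.tgt b)
  · have hne : l ≠ [] := by
      rintro rfl
      simp at hl; omega
    have := h ⟨l, hne, hc⟩ hl
    rw [pathElem, map_list_prod, List.map_map] at this
    exact this
  · exact prod_arrows_eq_zero_of_not_chain φ l hc

variable (Q) in
/-- The relation of being joined by an arrow which is not a loop. -/
def JoinedByArrow (j k : Q.V) : Prop := ∃ a, Q.src a = j ∧ Q.tgt a = k ∧ j ≠ k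

theorem exists_mem_repSet_one_ne_zero (φ : PathAlgebra K Q →ₐ[K] A) {a : Q.A}
    (ha : Q.src a ≠ Q.tgt a) : ∃ y ∈ RepSet K Q φ (fun _ => 1),
      y a ⟨Q.tgt a, 0⟩ ⟨Q.src a, 0⟩ ≠ 0 := by
  let s : Matrix (RepIx Q fun _ => 1) (RepIx Q fun _ => 1) K :=
    Matrix.single ⟨Q.tgt a, 0⟩ ⟨Q.src a, 0⟩ 1
  have hss : s * s = 0 :=
    Matrix.single_mul_single_of_ne _ _ _ _ (fun h => ha (congrArg Sigma.fst h)) _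
  refine ⟨fun b => if b = a then s else 0, ⟨fun b u v h => ?_, fun c i j hc _ => ?_⟩, by simp [s]⟩
  · by_cases hb : b = a
    · subst hb
      replace h : s u v ≠ 0 := by simpa using h
      by_contra hne
      apply h
      apply Matrix.single_apply_of_ne
      rintro ⟨rfl, rfl⟩
      exact hne ⟨rfl, rfl⟩
    · simp [hb] at h
  · refine Finset.sum_eq_zero fun p hp => ?_
    have hlen := (hc p hp).1
    suffices h : pathProd K Q _ (fun b => if b = a then s else 0) p = 0 by
      change c p • pathProd K Q _ _ p = 0
      rw [h, smul_zero]
    obtain ⟨l, hne, hch⟩ := p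
    match l, hne, hch, hlen with
    | b :: b' :: l, _, _, _ =>
      rw [pathProd, List.map_cons, List.map_cons, List.prod_cons, List.prod_cons, ← mul_assoc]
      split_ifs <;> simp [hss]

theorem not_transGen_joinedByArrow (hadm : IsAdmissiblePresentation K Q φ)
    (hirr : IsGeomIrreducible K Q φ) (i : Q.V) : ¬ Relation.TransGen (JoinedByArrow Q) i i := by
  obtain ⟨y, hy, hne⟩ := exists_prod_nonvanishing (hirr fun _ => 1)
    (fun a => MvPolynomial.X (a, ⟨Q.tgt a, 0⟩, ⟨Q.src a, 0⟩))
    (Finset.univ.filter fun a => Q.src a ≠ Q.tgt a) (fun a ha => by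
      obtain ⟨y, hy, h⟩ := exists_mem_repSet_one_ne_zero φ (Finset.mem_filter.1 ha).2
      exact ⟨y, hy, by simpa [repCoords] using h⟩)
  obtain ⟨ρ, -, hρa⟩ := exists_algHom_of_mem_repSet hadm hy
  have base : ∀ {j k}, JoinedByArrow Q j k → ∃ l : List Q.A, l ≠ [] ∧ ∃ c : K, c ≠ 0 ∧
      ρ (l.map fun a => φ (arrowElem K Q a)).prod = Matrix.single ⟨k, 0⟩ ⟨j, 0⟩ c := by
    rintro _ _ ⟨a, rfl, rfl, ha⟩
    have h := hne a (by simpa using ha)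
    refine ⟨[a], by simp, y a ⟨Q.tgt a, 0⟩ ⟨Q.src a, 0⟩, by simpa [repCoords] using h, ?_⟩
    rw [List.map_singleton, List.prod_singleton, hρa]
    ext ⟨p, p'⟩ ⟨q, q'⟩
    obtain rfl := Subsingleton.elim p' 0
    obtain rfl := Subsingleton.elim q' 0
    by_cases h : p = Q.tgt a ∧ q = Q.src a
    · obtain ⟨rfl, rfl⟩ := h
      simp
    · rw [Matrix.single_apply_of_ne]
      · by_contra hn
        exact h (hy.1 a _ _ hn)
      · rintro ⟨h1, h2⟩
        exact h ⟨(congrArg Sigma.fst h1).symm, (congrArg Sigma.fst h2).symm⟩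
  have key : ∀ {j k}, Relation.TransGen (JoinedByArrow Q) j k → ∃ l : List Q.A, l ≠ [] ∧ ∃ c : K,
      c ≠ 0 ∧ ρ (l.map fun a => φ (arrowElem K Q a)).prod = Matrix.single ⟨k, 0⟩ ⟨j, 0⟩ c := by
    intro j k h
    induction h with
    | single h => exact base h
    | tail _ h ih =>
      obtain ⟨l, -, c, hc, e⟩ := ih
      obtain ⟨l', hl', c', hc', e'⟩ := base h
      refine ⟨l' ++ l, by simp [hl'], c' * c, mul_ne_zero hc' hc, ?_⟩
      rw [List.map_append, List.prod_append, map_mul, e, e', Matrix.single_mul_single_same]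
  intro h
  obtain ⟨l, hl, c, hc, e⟩ := key h
  obtain ⟨m, hm⟩ := exists_prod_arrows_eq_zero hadm
  let o : RepIx Q fun _ => 1 := ⟨i, 0⟩
  have hpow : ∀ k, Matrix.single o o c ^ (k + 1) = Matrix.single o o (c ^ (k + 1)) := by
    intro k
    induction k with
    | zero => simp
    | succ k ih => rw [pow_succ, ih, Matrix.single_mul_single_same, ← pow_succ]
  have h0 : (l.map fun a => φ (arrowElem K Q a)).prod ^ (m + 1) = 0 := by
    rw [← hm (List.replicate (m + 1) l).flatten]
    · rw [List.map_flatten, List.prod_flatten]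
      simp
    · have := List.length_pos_iff.2 hl
      simp only [List.length_flatten, List.map_replicate, List.sum_replicate, smul_eq_mul]
      nlinarith
  have h1 := congrArg ρ h0
  rw [map_pow, e, map_zero] at h1
  replace h1 := (hpow m).symm.trans h1
  have := congrFun (congrFun h1 o) o
  rw [Matrix.single_apply_same] at this
  exact pow_ne_zero _ hc this

theorem reflTransGen_of_ne_zero (hφ : Function.Surjective φ) {j k : Q.V} {z : A}
    (h : φ (vertexElem K Q k) * z * φ (vertexElem K Q j) ≠ 0) :
    Relation.ReflTransGen (JoinedByArrow Q) j k := by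
  have orth : ∀ {i j}, i ≠ j → φ (vertexElem K Q i) * φ (vertexElem K Q j) = 0 := fun h => by
    rw [← map_mul, vertexElem_mul_of_ne K Q h, map_zero]
  have hsum : ∑ i, φ (vertexElem K Q i) = 1 := by
    rw [← map_sum, sum_vertexElem, map_one]
  let P : Subalgebra K A :=
    { carrier := {z | ∀ j k, φ (vertexElem K Q k) * z * φ (vertexElem K Q j) ≠ 0 →
        Relation.ReflTransGen (JoinedByArrow Q) j k}
      mul_mem' := by
        intro z w hz hw j k h
        have e : φ (vertexElem K Q k) * (z * w) * φ (vertexElem K Q j) =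
            ∑ i, (φ (vertexElem K Q k) * z * φ (vertexElem K Q i)) *
              (φ (vertexElem K Q i) * w * φ (vertexElem K Q j)) := by
          calc _ = φ (vertexElem K Q k) * z * (∑ i, φ (vertexElem K Q i)) * w *
                φ (vertexElem K Q j) := by rw [hsum, mul_one]; simp only [mul_assoc]
            _ = _ := by
              rw [Finset.mul_sum, Finset.sum_mul, Finset.sum_mul]
              refine Finset.sum_congr rfl fun i _ => ?_
              have : φ (vertexElem K Q i) * φ (vertexElem K Q i) = φ (vertexElem K Q i) := by
                rw [← map_mul, vertexElem_mul_self]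
              conv_lhs => rw [← this]
              simp only [mul_assoc]
        rw [e] at h
        obtain ⟨i, -, hi⟩ := Finset.exists_ne_zero_of_sum_ne_zero h
        exact (hw j i (right_ne_zero_of_mul hi)).trans (hz i k (left_ne_zero_of_mul hi))
      add_mem' := by
        intro z w hz hw j k h
        by_cases hz0 : φ (vertexElem K Q k) * z * φ (vertexElem K Q j) = 0
        · refine hw j k ?_
          rwa [mul_add, add_mul, hz0, zero_add] at h
        · exact hz j k hz0
      algebraMap_mem' := by
        intro r j k h
        by_cases hjk : k = j
        · rw [hjk]
        · rw [← Algebra.commutes, mul_assoc, orth hjk, mul_zero] at h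
          exact absurd rfl h }
  refine (mem_of_generators hφ P (fun i j k h => ?_) (fun a j k h => ?_) z : z ∈ P) j k h
  · by_cases hki : k = i
    · by_cases hij : i = j
      · rw [hki, hij]
      · rw [mul_assoc, orth hij, mul_zero] at h
        exact absurd rfl h
    · rw [orth hki, zero_mul] at h
      exact absurd rfl h
  · rw [← arrowElem_mul_src, ← vertexElem_tgt_mul, map_mul, map_mul] at h
    by_cases hk : k = Q.tgt a
    · by_cases hj : Q.src a = j
      · by_cases hl : Q.src a = Q.tgt a
        · rw [hk, ← hj, hl]
        · exact .single ⟨a, hj, hk.symm, by rwa [hk, ← hj]⟩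
      · rw [mul_assoc, mul_assoc, orth hj, mul_zero, mul_zero] at h
        exact absurd rfl h
    · rw [← mul_assoc, ← mul_assoc, orth hk, zero_mul, zero_mul, zero_mul] at h
      exact absurd rfl h

theorem vertex_mul_mul_vertex_eq_zero (hadm : IsAdmissiblePresentation K Q φ)
    (hirr : IsGeomIrreducible K Q φ) {i j : Q.V} (hij : j ≠ i) (z w : A) :
    φ (vertexElem K Q i) * z * φ (vertexElem K Q j) *
      (φ (vertexElem K Q j) * w * φ (vertexElem K Q i)) = 0 := by
  by_contra h
  have h1 := reflTransGen_of_ne_zero hadm.1 (left_ne_zero_of_mul h)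
  have h2 := reflTransGen_of_ne_zero hadm.1 (right_ne_zero_of_mul h)
  rcases Relation.reflTransGen_iff_eq_or_transGen.1 h1 with h1 | h1
  · exact hij h1.symm
  · exact not_transGen_joinedByArrow hadm hirr i (Relation.TransGen.trans_right h2 h1)

end Acyclicity

section Corners

variable {K Q} {A : Type} [Ring A] [Algebra K A] {φ : PathAlgebra K Q →ₐ[K] A}

theorem map_vertexElem_mul_self (φ : PathAlgebra K Q →ₐ[K] A) (i : Q.V) :
    φ (vertexElem K Q i) * φ (vertexElem K Q i) = φ (vertexElem K Q i) := by
  rw [← map_mul, vertexElem_mul_self]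

theorem vertex_mul_mul_mul_vertex (hadm : IsAdmissiblePresentation K Q φ)
    (hirr : IsGeomIrreducible K Q φ) (i : Q.V) (z w : A) :
    φ (vertexElem K Q i) * (z * w) * φ (vertexElem K Q i) =
      φ (vertexElem K Q i) * z * (φ (vertexElem K Q i) * w * φ (vertexElem K Q i)) := by
  have hsum : ∑ j, φ (vertexElem K Q j) = 1 := by
    rw [← map_sum, sum_vertexElem, map_one]
  calc _ = φ (vertexElem K Q i) * z * (∑ j, φ (vertexElem K Q j)) * w * φ (vertexElem K Q i) := by
        rw [hsum, mul_one]; simp only [mul_assoc]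
    _ = ∑ j, φ (vertexElem K Q i) * z * (φ (vertexElem K Q j) * w * φ (vertexElem K Q i)) := by
        rw [Finset.mul_sum, Finset.sum_mul, Finset.sum_mul]
        exact Finset.sum_congr rfl fun j _ => by simp only [mul_assoc]
    _ = _ := by
        refine Finset.sum_eq_single i (fun j _ hj => ?_) (by simp)
        rw [← vertex_mul_mul_vertex_eq_zero hadm hirr hj z w, mul_assoc _ (φ (vertexElem K Q j)),
          ← mul_assoc (φ (vertexElem K Q j)), ← mul_assoc (φ (vertexElem K Q j)),
          map_vertexElem_mul_self]

variable (φ) in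
/-- The subspace `eᵢAeᵢ` of `A`. -/
def vertexCorner (i : Q.V) : Submodule K A where
  carrier := {z | φ (vertexElem K Q i) * z = z ∧ z * φ (vertexElem K Q i) = z}
  zero_mem' := by simp
  add_mem' h h' := ⟨by rw [mul_add, h.1, h'.1], by rw [add_mul, h.2, h'.2]⟩
  smul_mem' c _ h := ⟨by rw [mul_smul_comm, h.1], by rw [smul_mul_assoc, h.2]⟩

theorem mem_vertexCorner {i : Q.V} {z : A} : z ∈ vertexCorner φ i ↔
    φ (vertexElem K Q i) * z = z ∧ z * φ (vertexElem K Q i) = z := Iff.rfl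

theorem vertexElem_mem_vertexCorner (φ : PathAlgebra K Q →ₐ[K] A) (i : Q.V) :
    φ (vertexElem K Q i) ∈ vertexCorner φ i :=
  ⟨map_vertexElem_mul_self φ i, map_vertexElem_mul_self φ i⟩

theorem mul_mem_vertexCorner {i : Q.V} {z w : A} (hz : z ∈ vertexCorner φ i)
    (hw : w ∈ vertexCorner φ i) : z * w ∈ vertexCorner φ i :=
  ⟨by rw [← mul_assoc, hz.1], by rw [mul_assoc, hw.2]⟩

variable (Q) in
/-- The loops at a vertex. -/
abbrev LoopAt (i : Q.V) : Type := {a : Q.A // Q.src a = i ∧ Q.tgt a = i}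

theorem loop_mem_vertexCorner (φ : PathAlgebra K Q →ₐ[K] A) {i : Q.V} (a : LoopAt Q i) :
    φ (arrowElem K Q a) ∈ vertexCorner φ i := by
  obtain ⟨a, hs, ht⟩ := a
  have hl := vertexElem_tgt_mul K Q a
  have hr := arrowElem_mul_src K Q a
  rw [ht] at hl
  rw [hs] at hr
  exact ⟨by rw [← map_mul, hl], by rw [← map_mul, hr]⟩

/-- Over a geometrically irreducible algebra, `eᵢAeᵢ` is a representation of `A` supported at
the vertex `i`. -/
theorem exists_vertexCorner_representation (hadm : IsAdmissiblePresentation K Q φ)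
    (hirr : IsGeomIrreducible K Q φ) (i : Q.V) :
    ∃ π : A →ₐ[K] Module.End K (vertexCorner φ i),
      ∀ z u, (π z u : A) = φ (vertexElem K Q i) * z * u := by
  let π₀ : A → Module.End K (vertexCorner φ i) := fun z =>
    { toFun := fun u => ⟨φ (vertexElem K Q i) * z * u, by
        rw [mem_vertexCorner, mul_assoc, mul_assoc, ← mul_assoc, map_vertexElem_mul_self,
          mul_assoc z, u.2.2]
        exact ⟨rfl, rfl⟩⟩
      map_add' := fun u v => Subtype.ext (mul_add _ _ _)
      map_smul' := fun c u => Subtype.ext (mul_smul_comm _ _ _) }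
  refine ⟨{
    toFun := π₀
    map_one' := ?_
    map_mul' := fun z w => ?_
    map_zero' := ?_
    map_add' := fun z w => ?_
    commutes' := fun c => ?_ }, fun z u => rfl⟩
  · ext u
    simp [π₀, u.2.1]
  · ext u
    simp only [π₀, LinearMap.coe_mk, AddHom.coe_mk, Module.End.mul_apply]
    have := congrArg (· * (u : A)) (vertex_mul_mul_mul_vertex hadm hirr i z w)
    simp only [mul_assoc, u.2.1] at this
    simpa only [mul_assoc] using this
  · ext u
    simp [π₀]
  · ext u
    simp [π₀, mul_add, add_mul]
  · ext u
    change φ (vertexElem K Q i) * algebraMap K A c * (u : A) = c • (u : A)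
    rw [← Algebra.commutes, mul_assoc, u.2.1, Algebra.smul_def]

variable {V : Type*} [AddCommGroup V] [Module K V]

variable (φ) in
/-- The combined action of all loops at a vertex. -/
def loopMap (ρ : A →ₐ[K] Module.End K V) (i : Q.V) : (LoopAt Q i → V) →ₗ[K] V :=
  ∑ a : LoopAt Q i, ρ (φ (arrowElem K Q a)) ∘ₗ LinearMap.proj a

theorem loopMap_apply (ρ : A →ₐ[K] Module.End K V) (i : Q.V) (w : LoopAt Q i → V) :
    loopMap φ ρ i w = ∑ a : LoopAt Q i, ρ (φ (arrowElem K Q a)) (w a) := by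
  simp [loopMap]

theorem finrank_vertexCorner_le [Module.Finite K A] (hadm : IsAdmissiblePresentation K Q φ)
    (hirr : IsGeomIrreducible K Q φ) {i : Q.V} {π : A →ₐ[K] Module.End K (vertexCorner φ i)}
    (hπ : ∀ z u, (π z u : A) = φ (vertexElem K Q i) * z * u) :
    Module.finrank K (vertexCorner φ i) ≤
      Module.finrank K (LinearMap.range (loopMap φ π i)) + 1 := by
  set R := LinearMap.range (loopMap φ π i) with hR
  let o : vertexCorner φ i := ⟨_, vertexElem_mem_vertexCorner φ i⟩
  have hloop : ∀ (a : LoopAt Q i) (u : vertexCorner φ i),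
      (π (φ (arrowElem K Q a)) u : A) = φ (arrowElem K Q a) * u := fun a u => by
    rw [hπ, (loop_mem_vertexCorner φ a).1]
  have hRmul : ∀ u ∈ R, ∀ s : vertexCorner φ i,
      (⟨u * s, mul_mem_vertexCorner u.2 s.2⟩ : vertexCorner φ i) ∈ R := by
    rintro _ ⟨w, rfl⟩ s
    refine ⟨fun a => ⟨w a * s, mul_mem_vertexCorner (w a).2 s.2⟩, Subtype.ext ?_⟩
    simp only [loopMap_apply, AddSubmonoidClass.coe_finsetSum, hloop, Finset.sum_mul, mul_assoc]
  have hloopR : ∀ a : LoopAt Q i, (⟨_, loop_mem_vertexCorner φ a⟩ : vertexCorner φ i) ∈ R := by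
    intro a
    refine ⟨Pi.single a o, Subtype.ext ?_⟩
    rw [loopMap_apply, Finset.sum_eq_single a (fun b _ hb => by simp [hb]) (by simp),
      Pi.single_eq_same, hloop]
    exact (loop_mem_vertexCorner φ a).2
  let S := Submodule.span K {o} ⊔ R
  let P : Subalgebra K A :=
    { carrier := {z | π z o ∈ S}
      mul_mem' := by
        intro z w hz hw
        obtain ⟨_, hc, r, hr, h⟩ := Submodule.mem_sup.1 hz
        obtain ⟨c, rfl⟩ := Submodule.mem_span_singleton.1 hc
        have e : π (z * w) o = c • π w o + ⟨r * (π w o : vertexCorner φ i),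
            mul_mem_vertexCorner r.2 (π w o).2⟩ := by
          apply Subtype.ext
          have h' : φ (vertexElem K Q i) * z * φ (vertexElem K Q i) =
            c • φ (vertexElem K Q i) + r := by
            rw [← hπ z o, ← h]; rfl
          rw [hπ]
          change _ = c • (π w o : A) + r * (π w o : A)
          rw [hπ]
          change _ * (z * w) * φ (vertexElem K Q i) = c • (_ * w * φ (vertexElem K Q i)) +
            r * (_ * w * φ (vertexElem K Q i))
          rw [vertex_mul_mul_mul_vertex hadm hirr]
          have := congrArg (· * (w * φ (vertexElem K Q i))) h'
          simp only [add_mul, smul_mul_assoc] at this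
          have hrr : (r : A) * φ (vertexElem K Q i) = r := r.2.2
          simp only [← mul_assoc, hrr] at this ⊢
          exact this
        change π (z * w) o ∈ S
        rw [e]
        exact add_mem (Submodule.smul_mem _ c hw) (Submodule.mem_sup_right (hRmul r hr _))
      add_mem' := by
        intro z w hz hw
        change π (z + w) o ∈ S
        rw [map_add, LinearMap.add_apply]
        exact add_mem hz hw
      algebraMap_mem' := by
        intro c
        change π (algebraMap K A c) o ∈ S
        rw [AlgHom.commutes, Module.algebraMap_end_apply]
        exact Submodule.mem_sup_left
          (Submodule.smul_mem _ c (Submodule.mem_span_singleton_self o)) }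
  have htop : Submodule.span K {o} ⊔ R = ⊤ := by
    refine eq_top_iff.2 fun u _ => ?_
    have hu : (u : A) ∈ P := by
      refine mem_of_generators hadm.1 P (fun j => ?_) (fun a => ?_) u
      · change π (φ (vertexElem K Q j)) o ∈ S
        by_cases hj : i = j
        · subst hj
          have : π (φ (vertexElem K Q i)) o = o := Subtype.ext (by
            rw [hπ]; simp only [o, map_vertexElem_mul_self])
          rw [this]
          exact Submodule.mem_sup_left (Submodule.mem_span_singleton_self o)
        · have : π (φ (vertexElem K Q j)) o = 0 := Subtype.ext (by
            rw [hπ, ← map_mul, vertexElem_mul_of_ne K Q hj, map_zero, zero_mul]; rfl)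
          rw [this]
          exact zero_mem _
      · change π (φ (arrowElem K Q a)) o ∈ S
        by_cases ha : Q.src a = i ∧ Q.tgt a = i
        · have : π (φ (arrowElem K Q a)) o = ⟨_, loop_mem_vertexCorner φ ⟨a, ha⟩⟩ :=
            Subtype.ext (by
              rw [hloop ⟨a, ha⟩]
              exact (loop_mem_vertexCorner φ ⟨a, ha⟩).2)
          rw [this]
          exact Submodule.mem_sup_right (hloopR _)
        · have : π (φ (arrowElem K Q a)) o = 0 := Subtype.ext (by
            rw [hπ]
            change φ _ * φ _ * φ _ = 0
            rw [← map_mul, ← map_mul, ← arrowElem_mul_src, ← vertexElem_tgt_mul]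
            by_cases h : Q.src a = i
            · rw [← mul_assoc, ← mul_assoc, vertexElem_mul_of_ne K Q fun h' => ha ⟨h, h'.symm⟩]
              simp
            · rw [mul_assoc, mul_assoc, vertexElem_mul_of_ne K Q h]
              simp)
          rw [this]
          exact zero_mem _
    have : π u o = u := Subtype.ext (by
      rw [hπ, u.2.1]
      exact u.2.2)
    rw [← this]
    exact hu
  calc _ = Module.finrank K (⊤ : Submodule K (vertexCorner φ i)) := (finrank_top K _).symm
    _ ≤ Module.finrank K (Submodule.span K {o}) + Module.finrank K R := by
      rw [← htop]; exact Submodule.finrank_add_le_finrank_add_finrank _ _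
    _ ≤ _ := by
      rw [add_comm]
      exact Nat.add_le_add_left ((finrank_span_le_card _).trans (by simp)) _

end Corners

theorem Matrix.exists_mul_mul_eq_one {F m n : Type*} [Field F] [Fintype m] [Fintype n]
    [DecidableEq m] [DecidableEq n] (B : Matrix m n F) :
    ∃ (L : Matrix (Fin B.rank) m F) (C : Matrix n (Fin B.rank) F), L * B * C = 1 := by
  let e : (Fin B.rank → F) ≃ₗ[F] LinearMap.range B.mulVecLin :=
    (Module.finBasis F (LinearMap.range B.mulVecLin)).equivFun.symm
  obtain ⟨s, hs⟩ := LinearMap.exists_rightInverse_of_surjective B.mulVecLin.rangeRestrict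
    (LinearMap.range_rangeRestrict _)
  obtain ⟨l, hl⟩ := LinearMap.exists_leftInverse_of_injective
    ((LinearMap.range B.mulVecLin).subtype ∘ₗ e.toLinearMap)
    (LinearMap.ker_eq_bot.2 (Subtype.val_injective.comp e.injective))
  refine ⟨LinearMap.toMatrix' l, LinearMap.toMatrix' (s ∘ₗ e.toLinearMap), ?_⟩
  have hB : LinearMap.toMatrix' B.mulVecLin = B := LinearMap.toMatrix'_toLin' B
  have key : l ∘ₗ B.mulVecLin ∘ₗ s ∘ₗ e.toLinearMap = LinearMap.id := by
    rw [← hl, ← LinearMap.comp_assoc e.toLinearMap, ← LinearMap.comp_assoc e.toLinearMap]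
    have h : B.mulVecLin ∘ₗ s = (LinearMap.range B.mulVecLin).subtype :=
      LinearMap.ext fun w => congrArg Subtype.val (LinearMap.congr_fun hs w)
    rw [h]; rfl
  have h := congrArg LinearMap.toMatrix' key
  rwa [LinearMap.toMatrix'_comp, LinearMap.toMatrix'_comp, LinearMap.toMatrix'_id, hB,
    ← Matrix.mul_assoc] at h

section LoopRank

variable {K Q} {n : Type} {A : Type} [Ring A] [Algebra K A] {φ : PathAlgebra K Q →ₐ[K] A}

/-- The matrices of the loops at a vertex, placed side by side. -/
def loopMatrix (x : Q.A → Matrix n n K) (i : Q.V) : Matrix n (LoopAt Q i × n) K :=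
  Matrix.of fun p q => x q.1 p q.2

variable [Fintype n]

theorem finrank_range_loopMap {V : Type*} [AddCommGroup V] [Module K V]
    {ρ : A →ₐ[K] Module.End K V} {x : Q.A → Matrix n n K} (ψ : (n → K) ≃ₗ[K] V)
    (hψ : ∀ a w, ψ ((x a).mulVec w) = ρ (φ (arrowElem K Q a)) (ψ w)) (i : Q.V) :
    Module.finrank K (LinearMap.range (loopMap φ ρ i)) = (loopMatrix x i).rank := by
  let η : (LoopAt Q i × n → K) ≃ₗ[K] (LoopAt Q i → V) :=
    LinearEquiv.curry K K (LoopAt Q i) n ≪≫ₗ LinearEquiv.piCongrRight fun _ => ψ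
  have h : loopMap φ ρ i ∘ₗ η.toLinearMap = ψ.toLinearMap ∘ₗ (loopMatrix x i).mulVecLin := by
    refine LinearMap.ext fun w => ?_
    simp only [LinearMap.comp_apply, LinearEquiv.coe_coe, loopMap_apply]
    have : ∀ a, η w a = ψ (fun q => w (a, q)) := fun a => rfl
    simp only [this, ← hψ, ← map_sum]
    congr 1
    ext p
    simp [loopMatrix, Matrix.mulVec, dotProduct, Fintype.sum_prod_type]
  rw [← LinearMap.range_comp_of_range_eq_top (loopMap φ ρ i) (f := η.toLinearMap)
    (LinearMap.range_eq_top.2 η.surjective), h, LinearMap.range_comp]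
  exact LinearEquiv.finrank_map_eq ψ _

variable {d : Q.V → ℕ}

theorem rank_loopMatrix_orbit_le {x y : RepSpace K Q d} (hy : y ∈ repOrbit K Q d x) (i : Q.V) :
    (loopMatrix y i).rank ≤ (loopMatrix x i).rank := by
  obtain ⟨g, hg⟩ := hy
  have h : loopMatrix y i = blockDiag K Q g * (loopMatrix x i *
      Matrix.kroneckerMap (· * ·) (1 : Matrix (LoopAt Q i) (LoopAt Q i) K)
        (blockDiag K Q fun i => (g i)⁻¹)) := by
    rw [← Matrix.mul_assoc]
    ext p q
    simp only [loopMatrix, Matrix.of_apply, hg]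
    rw [Matrix.mul_apply, Matrix.mul_apply, Fintype.sum_prod_type, Finset.sum_eq_single q.1]
    · simp [Matrix.mul_apply]
    · intro b _ hb
      simp [Matrix.one_apply_ne hb]
    · simp
  rw [h]
  exact (Matrix.rank_mul_le_right _ _).trans (Matrix.rank_mul_le_left _ _)

theorem rank_loopMatrix_le {x y : RepSpace K Q d}
    (h : ∀ f : MvPolynomial (Q.A × RepIx Q d × RepIx Q d) K,
      (∀ z ∈ repOrbit K Q d x, MvPolynomial.eval (repCoords z) f = 0) →
      MvPolynomial.eval (repCoords y) f = 0) (i : Q.V) :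
    (loopMatrix y i).rank ≤ (loopMatrix x i).rank := by
  obtain ⟨L, C, hLC⟩ := Matrix.exists_mul_mul_eq_one (loopMatrix y i)
  let P := MvPolynomial (Q.A × RepIx Q d × RepIx Q d) K
  let G : Matrix (RepIx Q d) (LoopAt Q i × RepIx Q d) P :=
    Matrix.of fun p q => MvPolynomial.X ((q.1 : Q.A), p, q.2)
  let L' : Matrix (Fin (loopMatrix y i).rank) (RepIx Q d) P := L.map MvPolynomial.C
  let C' : Matrix (LoopAt Q i × RepIx Q d) (Fin (loopMatrix y i).rank) P := C.map MvPolynomial.C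
  let f : P := Matrix.det (L' * G * C')
  have hf : ∀ z, MvPolynomial.eval (repCoords z) f = (L * loopMatrix z i * C).det := by
    intro z
    rw [RingHom.map_det]
    congr 1
    have hL : L'.map (MvPolynomial.eval (repCoords z)) = L := by ext; simp [L']
    have hC : C'.map (MvPolynomial.eval (repCoords z)) = C := by ext; simp [C']
    have hG : G.map (MvPolynomial.eval (repCoords z)) = loopMatrix z i := by
      ext; simp [G, loopMatrix, repCoords]
    rw [RingHom.mapMatrix_apply, Matrix.map_mul, Matrix.map_mul, hL, hC, hG]
  have h1 : MvPolynomial.eval (repCoords y) f ≠ 0 := by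
    rw [hf, hLC, Matrix.det_one]; exact one_ne_zero
  obtain ⟨z, hz, hne⟩ : ∃ z ∈ repOrbit K Q d x, MvPolynomial.eval (repCoords z) f ≠ 0 := by
    by_contra! hz
    exact h1 (h f hz)
  rw [hf] at hne
  calc (loopMatrix y i).rank = (L * loopMatrix z i * C).rank := by
        rw [Matrix.rank_of_isUnit _ ((Matrix.isUnit_iff_isUnit_det _).2 (isUnit_iff_ne_zero.2 hne)),
          Fintype.card_fin]
    _ ≤ (loopMatrix z i).rank := (Matrix.rank_mul_le_left _ _).trans (Matrix.rank_mul_le_right _ _)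
    _ ≤ _ := rank_loopMatrix_orbit_le hz i

theorem exists_mem_repSet_of_representation {V : Type*} [AddCommGroup V] [Module K V]
    (ρ : A →ₐ[K] Module.End K V) (ψ : (RepIx Q d → K) ≃ₗ[K] V)
    (hψ : ∀ i w, ψ ((vertexProj K Sigma.fst i).mulVec w) = ρ (φ (vertexElem K Q i)) (ψ w)) :
    ∃ y ∈ RepSet K Q φ d, ∀ a w, ψ ((y a).mulVec w) = ρ (φ (arrowElem K Q a)) (ψ w) := by
  let ρ' : A →ₐ[K] Matrix (RepIx Q d) (RepIx Q d) K :=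
    (LinearMap.toMatrixAlgEquiv'.toAlgHom.comp (ψ.symm.conjAlgEquiv K).toAlgHom).comp ρ
  have hρ' : ∀ z w, (ρ' z).mulVec w = ψ.symm (ρ z (ψ w)) := fun z w => by
    change (LinearMap.toMatrix' (ψ.symm.conjAlgEquiv K (ρ z))).mulVec w = _
    rw [LinearMap.toMatrix'_mulVec]
    simp [LinearEquiv.conjAlgEquiv_apply]
  refine ⟨_, mem_repSet_of_algHom ρ' fun i => ?_, fun a w => ?_⟩
  · refine Matrix.ext_of_mulVec_single fun k => ?_
    rw [hρ', ← hψ, ψ.symm_apply_apply]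
  · rw [hρ', ψ.apply_symm_apply]

end LoopRank

section RankInequality

variable {K Q} {A : Type} [Ring A] [Algebra K A] {φ : PathAlgebra K Q →ₐ[K] A}

section Products

variable {ι V : Type*} [AddCommGroup V] [Module K V]

theorem exists_pi_representation (θ : ι → A →ₐ[K] Module.End K V) :
    ∃ ρ : A →ₐ[K] Module.End K (ι → V), ∀ z w u, ρ z w u = θ u z (w u) := by
  refine ⟨{
    toFun := fun z => LinearMap.pi fun u => θ u z ∘ₗ LinearMap.proj u
    map_one' := ?_
    map_mul' := fun z w => ?_
    map_zero' := ?_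
    map_add' := fun z w => ?_
    commutes' := fun c => ?_ }, fun z w u => rfl⟩
  all_goals refine LinearMap.ext fun w => funext fun u => ?_
  · simp
  · simp
  · simp
  · simp
  · simp [AlgHom.commutes]

variable {ρ : A →ₐ[K] Module.End K (ι → V)} {θ : ι → A →ₐ[K] Module.End K V}
  (h : ∀ z w u, ρ z w u = θ u z (w u))

include h

theorem loopMap_pi (i : Q.V) (w : LoopAt Q i → ι → V) (u : ι) :
    loopMap φ ρ i w u = loopMap φ (θ u) i fun a => w a u := by
  simp [loopMap_apply, h]

variable [Fintype ι] [Module.Finite K V]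

theorem finrank_range_loopMap_pi_le {π : A →ₐ[K] Module.End K V} (hθ : ∀ u, θ u = π) (i : Q.V) :
    Module.finrank K (LinearMap.range (loopMap φ ρ i)) ≤
      Fintype.card ι * Module.finrank K (LinearMap.range (loopMap φ π i)) := by
  let f : LinearMap.range (loopMap φ ρ i) →ₗ[K] (ι → LinearMap.range (loopMap φ π i)) :=
    LinearMap.pi fun u => (LinearMap.proj u ∘ₗ Submodule.subtype _).codRestrict _ (by
      rintro ⟨_, w, rfl⟩
      refine ⟨fun a => w a u, ?_⟩
      rw [← hθ u, ← loopMap_pi h]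
      rfl)
  have hf : Function.Injective f := fun v v' hv => Subtype.ext (funext fun u =>
    congrArg Subtype.val (congrFun hv u))
  calc _ ≤ _ := LinearMap.finrank_le_finrank_of_injective hf
    _ = _ := by rw [Module.finrank_pi_fintype]; simp

theorem card_mul_finrank_range_loopMap_le {π : A →ₐ[K] Module.End K V} (p : ι → Prop)
    [DecidablePred p] (hθ : ∀ u, p u → θ u = π) (i : Q.V) :
    Fintype.card {u // p u} * Module.finrank K (LinearMap.range (loopMap φ π i)) ≤
      Module.finrank K (LinearMap.range (loopMap φ ρ i)) := by
  let f : ({u // p u} → LinearMap.range (loopMap φ π i)) →ₗ[K] LinearMap.range (loopMap φ ρ i) :=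
    { toFun := fun v => ⟨fun u => if hu : p u then v ⟨u, hu⟩ else 0, by
        choose w hw using fun u => (v u).2
        refine ⟨fun a u => if hu : p u then w ⟨u, hu⟩ a else 0, funext fun u => ?_⟩
        rw [loopMap_pi h]
        by_cases hu : p u
        · simp only [hu, dite_true]
          rw [hθ u hu, ← hw ⟨u, hu⟩]
        · simp only [hu, dite_false]
          exact map_zero _⟩
      map_add' := fun v v' => Subtype.ext (funext fun u => by
        by_cases hu : p u <;> simp [hu])
      map_smul' := fun c v => Subtype.ext (funext fun u => by
        by_cases hu : p u <;> simp [hu]) }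
  have hf : Function.Injective f := fun v v' hv => funext fun u => Subtype.ext (by
    have := congrFun (congrArg Subtype.val hv) u
    simpa [f, u.2] using this)
  calc _ = Module.finrank K ({u // p u} → LinearMap.range (loopMap φ π i)) := by
        rw [Module.finrank_pi_fintype]; simp
    _ ≤ _ := LinearMap.finrank_le_finrank_of_injective hf

end Products

theorem exists_simple_representation (hadm : IsAdmissiblePresentation K Q φ) (j : Q.V) :
    ∃ χ : A →ₐ[K] K, ∀ k, χ (φ (vertexElem K Q k)) = if j = k then 1 else 0 := by
  obtain ⟨χ, hχ, -⟩ := exists_algHom_of_relations (B := K) hadm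
    (fun k => if j = k then 1 else 0) (fun _ => 0) (by simp)
    (fun k l hkl => by
      by_cases hk : j = k
      · simp [← hk, hk ▸ hkl]
      · simp [hk])
    (by simp) (by simp) (by simp) (fun c k l _ _ => Finset.sum_eq_zero fun p _ => by
      have : (p.arrows.map fun _ => (0 : K)).prod = 0 :=
        List.prod_eq_zero (by simpa using p.ne)
      simp only [this, smul_zero])
  exact ⟨χ, hχ⟩

variable {d : Q.V → ℕ}

/-- The index type of the `b`-fold multiple of a dimension vector. -/
def repIxMulEquiv (d : Q.V → ℕ) (b : ℕ) : RepIx Q d × Fin b ≃ RepIx Q fun j => d j * b :=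
  (Equiv.sigmaProdDistrib _ _).trans (Equiv.sigmaCongrRight fun _ => finProdFinEquiv)

theorem vertexProj_mulVec_repIxMulEquiv {b : ℕ} (j : Q.V)
    (w : RepIx Q (fun j => d j * b) → K) (u : RepIx Q d) (k : Fin b) :
    (vertexProj K Sigma.fst j).mulVec w (repIxMulEquiv d b (u, k)) =
      if u.1 = j then w (repIxMulEquiv d b (u, k)) else 0 := by
  rw [vertexProj, Matrix.mulVec_diagonal, ite_mul, one_mul, zero_mul]
  rfl

theorem mul_finrank_range_loopMap_le [Infinite K] [Module.Finite K A]
    (hadm : IsAdmissiblePresentation K Q φ) (hirr : IsGeomIrreducible K Q φ)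
    {M : Type} [AddCommGroup M] [Module K M] [Module A M] [IsScalarTower K A M]
    [Module.Finite K M] (hM : RigidModule A M) {x : RepSpace K Q d}
    {ψ : (RepIx Q d → K) ≃ₗ[K] M} (hψ : IsRealization φ Sigma.fst x ψ)
    {i : Q.V} {π : A →ₐ[K] Module.End K (vertexCorner φ i)}
    (hπ : ∀ z u, (π z u : A) = φ (vertexElem K Q i) * z * u) :
    d i * Module.finrank K (LinearMap.range (loopMap φ π i)) ≤
      Module.finrank K (vertexCorner φ i) *
        Module.finrank K (LinearMap.range (loopMap φ (Algebra.lsmul K K M) i)) := by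
  set b := Module.finrank K (vertexCorner φ i) with hb
  choose χ hχ using exists_simple_representation hadm
  let θ : RepIx Q d → A →ₐ[K] Module.End K (vertexCorner φ i) := fun u =>
    if u.1 = i then π else (Algebra.ofId K _).comp (χ u.1)
  have hθ : ∀ u j w, θ u (φ (vertexElem K Q j)) w = if u.1 = j then w else 0 := by
    intro u j w
    by_cases hu : u.1 = i
    · simp only [θ, hu, if_true]
      refine Subtype.ext ?_
      rw [hπ]
      by_cases hj : i = j
      · rw [if_pos hj, ← hj, map_vertexElem_mul_self, w.2.1]
      · rw [if_neg hj, ← map_mul, vertexElem_mul_of_ne K Q hj, map_zero, zero_mul]; rfl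
    · simp only [θ, hu, if_false, AlgHom.comp_apply, hχ]
      split_ifs <;> simp
  obtain ⟨ρN, hρN⟩ := exists_pi_representation θ
  let β : (Fin b → K) ≃ₗ[K] vertexCorner φ i :=
    (Module.finBasis K (vertexCorner φ i)).equivFun.symm
  let ψN : (RepIx Q (fun j => d j * b) → K) ≃ₗ[K] (RepIx Q d → vertexCorner φ i) :=
    LinearEquiv.funCongrLeft K K (repIxMulEquiv d b) ≪≫ₗ
      LinearEquiv.curry K K (RepIx Q d) (Fin b) ≪≫ₗ LinearEquiv.piCongrRight fun _ => β
  have hψN : ∀ w u, ψN w u = β fun k => w (repIxMulEquiv d b (u, k)) := fun _ _ => rfl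
  obtain ⟨yN, hyN, hyN'⟩ := exists_mem_repSet_of_representation ρN ψN fun j w => by
    ext1 u
    rw [hρN, hθ, hψN, hψN]
    simp only [vertexProj_mulVec_repIxMulEquiv]
    split_ifs with h
    · rfl
    · exact map_zero β
  let ψM : (RepIx Q (fun j => d j * b) → K) ≃ₗ[K] (Fin b → M) :=
    LinearEquiv.funCongrLeft K K ((Equiv.prodComm _ _).trans (repIxMulEquiv d b)) ≪≫ₗ
      LinearEquiv.curry K K (Fin b) (RepIx Q d) ≪≫ₗ LinearEquiv.piCongrRight fun _ => ψ
  have hψM : ∀ w k, ψM w k = ψ fun u => w (repIxMulEquiv d b (u, k)) := fun _ _ => rfl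
  have hψMv : ∀ j w, ψM ((vertexProj K Sigma.fst j).mulVec w) =
      Algebra.lsmul K K (Fin b → M) (φ (vertexElem K Q j)) (ψM w) := fun j w => by
    ext1 k
    change _ = φ (vertexElem K Q j) • ψM w k
    rw [hψM, hψM, ← hψ.vertex]
    congr 1
    ext u
    rw [vertexProj_mulVec_repIxMulEquiv, vertexProj, Matrix.mulVec_diagonal, ite_mul, one_mul,
      zero_mul]
  obtain ⟨yM, hyM, hyM'⟩ := exists_mem_repSet_of_representation _ ψM hψMv
  have hrank := rank_loopMatrix_le (x := yM) (y := yN) (fun f hf =>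
    eval_eq_zero_of_orbit hadm (RigidModule.pi (ι := Fin b) hM) (hirr _) hyM
      (ψ := ψM) ⟨hyM', hψMv⟩ hf hyN) i
  rw [← finrank_range_loopMap ψN hyN', ← finrank_range_loopMap ψM hyM'] at hrank
  have hcard : Fintype.card {u : RepIx Q d // u.1 = i} = d i := by
    rw [Fintype.card_congr (Equiv.sigmaSubtype i), Fintype.card_fin]
  have h1 := card_mul_finrank_range_loopMap_le (φ := φ) hρN (fun u => u.1 = i) (π := π)
    (fun u hu => if_pos hu) i
  have h2 := finrank_range_loopMap_pi_le (φ := φ) (ρ := Algebra.lsmul K K (Fin b → M))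
    (θ := fun _ => Algebra.lsmul K K M) (fun _ _ _ => rfl) (fun _ => rfl) i
  rw [hcard] at h1
  rw [Fintype.card_fin] at h2
  exact (h1.trans hrank).trans h2

end RankInequality

section LocalFreeness

variable {K Q} {A : Type} [Ring A] [Algebra K A] {φ : PathAlgebra K Q →ₐ[K] A}
  {M : Type} [AddCommGroup M] [Module K M] [Module A M] [IsScalarTower K A M]

variable (K φ M) in
/-- The subspace `eᵢM` of `M`. -/
def vertexSpace (i : Q.V) : Submodule K M where
  carrier := {m | φ (vertexElem K Q i) • m = m}
  zero_mem' := smul_zero _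
  add_mem' h h' := by
    rw [Set.mem_ofPred_eq] at h h' ⊢
    rw [smul_add, h, h']
  smul_mem' c m h := by
    rw [Set.mem_ofPred_eq] at h ⊢
    rw [smul_comm, h]

theorem mem_vertexSpace {i : Q.V} {m : M} :
    m ∈ vertexSpace K φ M i ↔ φ (vertexElem K Q i) • m = m := Iff.rfl

theorem smul_mem_vertexSpace {i : Q.V} {z : A} (hz : z ∈ vertexCorner φ i) (m : M) :
    z • m ∈ vertexSpace K φ M i := by
  rw [mem_vertexSpace, smul_smul, hz.1]

theorem finrank_vertexSpace {d : Q.V → ℕ} {x : RepSpace K Q d} {ψ : (RepIx Q d → K) ≃ₗ[K] M}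
    (hψ : IsRealization φ Sigma.fst x ψ) (i : Q.V) :
    Module.finrank K (vertexSpace K φ M i) = d i := by
  classical
  have h : vertexSpace K φ M i = (LinearMap.range
      (vertexProj K (Sigma.fst : RepIx Q d → Q.V) i).mulVecLin).map ψ.toLinearMap := by
    ext m
    constructor
    · intro hm
      refine ⟨_, ⟨ψ.symm m, rfl⟩, ?_⟩
      rw [Matrix.mulVecLin_apply, LinearEquiv.coe_coe, hψ.vertex, ψ.apply_symm_apply]
      exact hm
    · rintro ⟨_, ⟨w, rfl⟩, rfl⟩
      rw [Matrix.mulVecLin_apply, LinearEquiv.coe_coe, hψ.vertex]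
      exact smul_mem_vertexSpace (vertexElem_mem_vertexCorner φ i) _
  rw [h, ψ.finrank_map_eq]
  change (vertexProj K Sigma.fst i).rank = d i
  rw [vertexProj, Matrix.rank_diagonal, Fintype.card_congr (Equiv.subtypeEquivRight
    (q := fun u : RepIx Q d => u.1 = i) fun u => by simp),
    Fintype.card_congr (Equiv.sigmaSubtype i), Fintype.card_fin]

theorem range_loopMap_le_vertexSpace (i : Q.V) :
    LinearMap.range (loopMap φ (Algebra.lsmul K K M) i) ≤ vertexSpace K φ M i := by
  rintro _ ⟨w, rfl⟩
  rw [loopMap_apply]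
  exact sum_mem fun a _ => smul_mem_vertexSpace (loop_mem_vertexCorner φ a) _

/-- A form of Nakayama's lemma: a subspace of `M` which is stable under the loops at `i` and
generates `eᵢM` modulo the image of these loops contains `eᵢM`. -/
theorem vertexSpace_le (hadm : IsAdmissiblePresentation K Q φ) {i : Q.V} {N : Submodule K M}
    (hN : ∀ (a : LoopAt Q i), ∀ m ∈ N, φ (arrowElem K Q a) • m ∈ N)
    (h : vertexSpace K φ M i ≤ N ⊔ LinearMap.range (loopMap φ (Algebra.lsmul K K M) i)) :
    vertexSpace K φ M i ≤ N := by
  let S : ℕ → Submodule K M := fun k => Submodule.span K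
    {m | ∃ l : List Q.A, l.length = k ∧ ∃ m' : M,
      m = (l.map fun a => φ (arrowElem K Q a)).prod • m'}
  have key : ∀ k, vertexSpace K φ M i ≤ N ⊔ S k := by
    intro k
    induction k with
    | zero =>
      exact fun m _ => Submodule.mem_sup_right (Submodule.subset_span ⟨[], rfl, m, by simp⟩)
    | succ k ih =>
      refine h.trans (sup_le le_sup_left ?_)
      rintro _ ⟨v, rfl⟩
      rw [loopMap_apply]
      refine sum_mem fun a _ => ?_
      have hle : N ⊔ S k ≤ (N ⊔ S (k + 1)).comap
          (Algebra.lsmul K K M (φ (arrowElem K Q a))) := by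
        refine sup_le (fun m hm => Submodule.mem_sup_left (hN a m hm)) (Submodule.span_le.2 ?_)
        rintro _ ⟨l, hl, m, rfl⟩
        refine Submodule.mem_sup_right (Submodule.subset_span ⟨a :: l, by simp [hl], m, ?_⟩)
        rw [List.map_cons, List.prod_cons, mul_smul]
        rfl
      have hmem : φ (arrowElem K Q a) • φ (vertexElem K Q i) • v a ∈ N ⊔ S (k + 1) :=
        hle (ih (smul_mem_vertexSpace (vertexElem_mem_vertexCorner φ i) (v a)))
      rw [smul_smul, (loop_mem_vertexCorner φ a).2] at hmem
      exact hmem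
  obtain ⟨m, hm⟩ := exists_prod_arrows_eq_zero hadm
  refine (key m).trans (sup_le le_rfl (Submodule.span_le.2 ?_))
  rintro _ ⟨l, hl, m', rfl⟩
  rw [hm l hl.ge, zero_smul]
  exact zero_mem N

theorem RigidModule.isLocallyFree [Infinite K] [Module.Finite K A]
    (hadm : IsAdmissiblePresentation K Q φ) (hirr : IsGeomIrreducible K Q φ)
    [Module.Finite K M] (hM : RigidModule A M) {d : Q.V → ℕ} {x : RepSpace K Q d}
    {ψ : (RepIx Q d → K) ≃ₗ[K] M} (hψ : IsRealization φ Sigma.fst x ψ) :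
    IsLocallyFree K Q φ M := by
  intro i
  obtain ⟨π, hπ⟩ := exists_vertexCorner_representation hadm hirr i
  have hdim := mul_finrank_range_loopMap_le hadm hirr hM hψ hπ
  have hcorner := finrank_vertexCorner_le hadm hirr hπ
  set R := LinearMap.range (loopMap φ (Algebra.lsmul K K M) i) with hR
  obtain ⟨C, hC⟩ := exists_isCompl R
  let W := C ⊓ vertexSpace K φ M i
  have hRW : R ⊔ W = vertexSpace K φ M i := by
    rw [← sup_inf_assoc_of_le C (range_loopMap_le_vertexSpace i), hC.sup_eq_top, top_inf_eq]
  have hW : Module.finrank K R + Module.finrank K W = d i := by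
    have h := Submodule.finrank_sup_add_finrank_inf_eq R W
    have h0 : R ⊓ W = ⊥ := by
      rw [← inf_assoc, hC.inf_eq_bot, bot_inf_eq]
    rw [h0, finrank_bot, add_zero, hRW, finrank_vertexSpace hψ] at h
    exact h.symm
  let w := Module.finBasis K W
  let F : (Fin (Module.finrank K W) → vertexCorner φ i) →ₗ[K] M :=
    { toFun := fun c => ∑ k, (c k : A) • (w k : M)
      map_add' := fun c c' => by simp [add_smul, Finset.sum_add_distrib]
      map_smul' := fun r c => by simp [Finset.smul_sum] }
  have hF : ∀ c, F c ∈ vertexSpace K φ M i := fun c => by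
    change ∑ k, (c k : A) • (w k : M) ∈ _
    exact sum_mem fun k _ => smul_mem_vertexSpace (c k).2 _
  have hsurj : vertexSpace K φ M i ≤ LinearMap.range F := by
    refine vertexSpace_le hadm ?_ ?_
    · rintro a _ ⟨c, rfl⟩
      refine ⟨fun k => ⟨_, mul_mem_vertexCorner (loop_mem_vertexCorner φ a) (c k).2⟩, ?_⟩
      change ∑ k, (φ (arrowElem K Q a) * (c k : A)) • (w k : M) =
        φ (arrowElem K Q a) • ∑ k, (c k : A) • (w k : M)
      simp only [Finset.smul_sum, mul_smul]
    · rw [← hRW, sup_comm]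
      refine sup_le_sup_right (fun m hm => ?_) _
      refine ⟨fun k => w.repr ⟨m, hm⟩ k • ⟨_, vertexElem_mem_vertexCorner φ i⟩, ?_⟩
      have h := congrArg Subtype.val (w.sum_repr ⟨m, hm⟩)
      rw [AddSubmonoidClass.coe_finsetSum] at h
      change ∑ k, (w.repr ⟨m, hm⟩ k • φ (vertexElem K Q i)) • (w k : M) = m
      refine (Finset.sum_congr rfl fun k _ => ?_).trans h
      rw [smul_assoc, (mem_vertexSpace.1 (w k).2.2)]
      rfl
  have hrange : LinearMap.range F = vertexSpace K φ M i :=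
    le_antisymm (by rintro _ ⟨c, rfl⟩; exact hF c) hsurj
  have hker : LinearMap.ker F = ⊥ := by
    have h := LinearMap.finrank_range_add_finrank_ker F
    rw [hrange, finrank_vertexSpace hψ, Module.finrank_pi_fintype, Finset.sum_const,
      Finset.card_univ, Fintype.card_fin, smul_eq_mul] at h
    refine Submodule.finrank_eq_zero.1 ?_
    nlinarith [Nat.mul_le_mul_left (d i) hcorner]
  let G : (Fin (Module.finrank K W) → Corner (vertexIdem K Q φ i)) →ₗ[Corner (vertexIdem K Q φ i)]
      CornerMod (vertexIdem K Q φ i) M :=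
    { toFun := fun c => ⟨F c, hF c⟩
      map_add' := fun c c' => Subtype.ext (F.map_add c c')
      map_smul' := fun r c => Subtype.ext (by
        change ∑ k, (r.1 * (c k).1) • (w k : M) = r.1 • ∑ k, (c k).1 • (w k : M)
        simp only [Finset.smul_sum, mul_smul]) }
  refine Module.Free.of_equiv (LinearEquiv.ofBijective G ⟨fun c c' h => ?_, fun m => ?_⟩)
  · exact LinearMap.ker_eq_bot.1 hker (congrArg Subtype.val h)
  · obtain ⟨c, hc⟩ := hsurj m.2
    exact ⟨c, Subtype.ext hc⟩

end LocalFreeness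

/-- Let `A = KQ/I` (with `I` admissible) be geometrically irreducible,
and let `M` be a rigid finite-dimensional `A`-module.  Then the Zariski closure of the
`G(d)`-orbit of (a representation point corresponding to) `M` in `rep(A,d)` is an
irreducible component of `rep(A,d)` (it is irreducible and maximal among irreducible
subsets), and consequently `M` is locally free. -/
theorem orbit_closure_of_rigid_is_irreducible_component [IsAlgClosed K]
    (A : Type) [Ring A] [Algebra K A] [Module.Finite K A]
    (φ : PathAlgebra K Q →ₐ[K] A) (hadm : IsAdmissiblePresentation K Q φ)
    (hirr : IsGeomIrreducible K Q φ)
    (M : Type) [AddCommGroup M] [Module K M] [Module A M] [IsScalarTower K A M]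
    [Module.Finite K M] (hM : RigidModule A M)
    (d : Q.V → ℕ) (x : RepSpace K Q d) (hx : x ∈ RepSet K Q φ d)
    (ψ : (RepIx Q d → K) ≃ₗ[K] M)
    (hψa : ∀ (a : Q.A) (v : RepIx Q d → K),
      ψ ((x a).mulVec v) = φ (arrowElem K Q a) • ψ v)
    (hψe : ∀ (i : Q.V) (v : RepIx Q d → K),
      ψ ((Matrix.diagonal fun u : RepIx Q d =>
        if u.1 = i then (1 : K) else 0).mulVec v) = φ (vertexElem K Q i) • ψ v) :
    (letI : TopologicalSpace (RepSpace K Q d) := repTopology K Q d;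
      (IsIrreducible (closure {y : ↥(RepSet K Q φ d) | ↑y ∈ repOrbit K Q d x}) ∧
      ∀ T : Set ↥(RepSet K Q φ d), IsIrreducible T →
        closure {y : ↥(RepSet K Q φ d) | ↑y ∈ repOrbit K Q d x} ⊆ T →
        T = closure {y : ↥(RepSet K Q φ d) | ↑y ∈ repOrbit K Q d x})) ∧
    IsLocallyFree K Q φ M := by
  have hψ : IsRealization φ Sigma.fst x ψ := ⟨hψa, hψe⟩
  refine ⟨?_, RigidModule.isLocallyFree hadm hirr hM hψ⟩
  have hcl := closure_orbit_eq_univ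
    (fun f hf y hy => eval_eq_zero_of_orbit hadm hM (hirr d) hx hψ hf hy)
    (repOrbit_subset_repSet hx)
  rw [hcl]
  exact ⟨isIrreducible_univ_repSet (hirr d), fun T _ hT => Set.univ_subset_iff.1 hT⟩
end
end
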